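/- arXiv:1210.2412 — 4 statements merged into one kernel-verified Lean document; each statement's English description precedes it below -/
import Mathlib

section
/- Let (P_i,ω_i) and (Q_i,τ_i) for i = 1,…,5 be labeled posets (any of which may be empty) such that (P_i,ω_i) ~ (Q_i,τ_i) for every i. Let P be the poset on the disjoint union P₁ ⊔ P₂ ⊔ P₃ ⊔ P₄ ⊔ P₅ whose order is generated by the orders of the individual P_i together with x < y for every x ∈ P₄ ∪ P₅ and every y ∈ P₁ ∪ P₂ ∪ P₃, and define the labeling ω : P → {1,…,|P|} by ω(a) = ω₃(a) for a ∈ P₃, ω(a) = ω₄(a) + |P₃| for a ∈ P₄, ω(a) = ω₁(a) + |P₃| + |P₄| for a ∈ P₁, ω(a) = ω₅(a) + |P₃| + |P₄| + |P₁| for a ∈ P₅, and ω(a) = ω₂(a) + |P₃| + |P₄| + |P₁| + |P₅| for a ∈ P₂ (so every covering edge from P₄ up to P₁ or P₂ is weak, every covering edge from P₄ up to P₃ is strict, every covering edge from P₅ up to P₁ or P₃ is strict, and every covering edge from P₅ up to P₂ is weak). Let (Q,τ) be constructed from the (Q_i,τ_i) in exactly the same way. Then (P,ω) ~ (Q,τ).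 -/
/-- A labeling of a finite poset: a bijection onto `{1, …, n}`. -/
def IsLabeling {α : Type*} (ω : α → ℕ) : Prop :=
  Set.BijOn ω Set.univ (Set.Icc 1 (Nat.card α))

/-- `f` is a `(P,ω)`-partition. -/
def IsPtn {α : Type*} [PartialOrder α] (ω : α → ℕ) (f : α → ℕ) : Prop :=
  (∀ a, 1 ≤ f a) ∧ (∀ a b : α, a ≤ b → f a ≤ f b) ∧
    (∀ a b : α, a ≤ b → ω b < ω a → f a < f b)

/-- The number of `(P,ω)`-partitions of weight `w`. -/
noncomputable def ptnCount {α : Type*} [PartialOrder α] (ω : α → ℕ) (w : ℕ →₀ ℕ) : ℕ :=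
  Set.ncard {f : α → ℕ | IsPtn ω f ∧ ∀ m : ℕ, 1 ≤ m → (f ⁻¹' {m}).ncard = w m}

/-- `(P,ω) ~ (Q,τ)`: equality of the `(P,ω)`-partition generating functions. -/
def KEq {α β : Type*} [PartialOrder α] [PartialOrder β] (ω : α → ℕ) (τ : β → ℕ) : Prop :=
  ∀ w : ℕ →₀ ℕ, ptnCount ω w = ptnCount τ w

/-- The poset `P` of Theorem 5.1 (Figure 7(a)): the disjoint union of `P₄` and `P₅` placed
entirely below the disjoint union of `P₁`, `P₂` and `P₃` (an ordinal sum, realized by the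
lexicographic sum order `⊕ₗ`). -/
abbrev BigPoset (α₁ α₂ α₃ α₄ α₅ : Type*) := (α₄ ⊕ α₅) ⊕ₗ (α₁ ⊕ α₂ ⊕ α₃)

/-- The labeling `ω` of `BigPoset`: labels of `P₃` first, then `P₄` shifted by `|P₃|`, then
`P₁`, then `P₅`, then `P₂`, so that all edges from `P₄` up to `P₁ ∪ P₂` are weak, all edges
from `P₄` up to `P₃` are strict, all edges from `P₅` up to `P₁ ∪ P₃` are strict, and all
edges from `P₅` up to `P₂` are weak. -/
def bigLabel {α₁ α₂ α₃ α₄ α₅ : Type*} [Fintype α₁] [Fintype α₃] [Fintype α₄] [Fintype α₅]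
    (ω₁ : α₁ → ℕ) (ω₂ : α₂ → ℕ) (ω₃ : α₃ → ℕ) (ω₄ : α₄ → ℕ) (ω₅ : α₅ → ℕ) :
    BigPoset α₁ α₂ α₃ α₄ α₅ → ℕ :=
  fun x =>
    Sum.elim
      (Sum.elim (fun a => ω₄ a + Fintype.card α₃)
        (fun a => ω₅ a + Fintype.card α₃ + Fintype.card α₄ + Fintype.card α₁))
      (Sum.elim (fun a => ω₁ a + Fintype.card α₃ + Fintype.card α₄)
        (Sum.elim
          (fun a => ω₂ a + Fintype.card α₃ + Fintype.card α₄ + Fintype.card α₁ +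
            Fintype.card α₅)
          ω₃))
      (ofLex x)

open Finsupp in
/-- The weight of `f`: the multiplicity with which it takes each value. -/
noncomputable def valueWeight {α : Type*} [Fintype α] (f : α → ℕ) : ℕ →₀ ℕ :=
  ∑ a, single (f a) 1

theorem valueWeight_apply {α : Type*} [Fintype α] (f : α → ℕ) (m : ℕ) :
    valueWeight f m = (f ⁻¹' {m}).ncard := by
  classical
  rw [valueWeight, Finsupp.finsetSum_apply]
  simp only [Finsupp.single_apply]
  rw [Finset.sum_boole, Set.ncard_eq_toFinset_card']
  simp only [Nat.cast_id]
  congr 1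
  ext a
  simp

theorem mem_support_valueWeight {α : Type*} [Fintype α] (f : α → ℕ) (m : ℕ) :
    m ∈ (valueWeight f).support ↔ ∃ a, f a = m := by
  rw [Finsupp.mem_support_iff, valueWeight_apply, Ne, Set.ncard_eq_zero, ← Ne,
    ← Set.nonempty_iff_ne_empty]
  rfl

theorem valueWeight_sum {α β : Type*} [Fintype α] [Fintype β] (f : α ⊕ β → ℕ) :
    valueWeight f = valueWeight (f ∘ Sum.inl) + valueWeight (f ∘ Sum.inr) :=
  Fintype.sum_sum_type _

theorem valueWeight_sumLex {α β : Type*} [Fintype α] [Fintype β] (f : α ⊕ₗ β → ℕ) :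
    valueWeight f =
      valueWeight (fun a => f (Sum.inlₗ a)) + valueWeight (fun b => f (Sum.inrₗ b)) := by
  have h : valueWeight f = valueWeight (f ∘ toLex) := (toLex.sum_comp _).symm
  rw [h, valueWeight_sum]
  rfl

theorem valueWeight_eq_iff {α : Type*} [Fintype α] {f : α → ℕ} (hf : ∀ a, 1 ≤ f a)
    {w : ℕ →₀ ℕ} (hw : w 0 = 0) :
    valueWeight f = w ↔ ∀ m : ℕ, 1 ≤ m → (f ⁻¹' {m}).ncard = w m := by
  constructor
  · rintro rfl m -
    rw [valueWeight_apply]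
  · intro h
    ext m
    rw [valueWeight_apply]
    rcases Nat.eq_zero_or_pos m with rfl | hm
    · rw [hw, Set.ncard_eq_zero]
      ext a
      have := hf a
      simp only [Set.mem_preimage, Set.mem_singleton_iff, Set.mem_empty_iff_false]
      lia
    · exact h m hm

theorem finite_valueWeight_fiber {α : Type*} [Fintype α] (w : ℕ →₀ ℕ) :
    {f : α → ℕ | valueWeight f = w}.Finite := by
  refine (Set.Finite.pi' fun _ : α => w.support.finite_toSet).subset ?_
  rintro f rfl a
  exact (mem_support_valueWeight f _).2 ⟨a, rfl⟩

theorem card_fiber_eq_ptnCount {α : Type*} [PartialOrder α] [Fintype α] (ω : α → ℕ)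
    {w : ℕ →₀ ℕ} (hw : w 0 = 0) :
    Nat.card {f : {f : α → ℕ // IsPtn ω f} // valueWeight f.1 = w} = ptnCount ω w := by
  rw [ptnCount, ← Nat.card_coe_set_eq]
  refine Nat.card_congr ((Equiv.subtypeSubtypeEquivSubtypeInter (IsPtn ω)
    fun f => valueWeight f = w).trans
      (Equiv.subtypeEquivRight fun f => and_congr_right fun hf => ?_))
  exact valueWeight_eq_iff hf.1 hw

/-- The count does not see the value of the weight at `0`. -/
theorem ptnCount_erase_zero {α : Type*} [PartialOrder α] (ω : α → ℕ) (w : ℕ →₀ ℕ) :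
    ptnCount ω (w.erase 0) = ptnCount ω w := by
  unfold ptnCount
  congr! 5 with f m
  refine imp_congr_right fun hm => ?_
  rw [Finsupp.erase_ne (by lia)]

theorem isEmpty_fiber {α : Type*} [PartialOrder α] [Fintype α] (ω : α → ℕ)
    {w : ℕ →₀ ℕ} (hw : w 0 ≠ 0) :
    IsEmpty {f : {f : α → ℕ // IsPtn ω f} // valueWeight f.1 = w} := by
  refine ⟨?_⟩
  rintro ⟨⟨f, hf⟩, rfl⟩
  obtain ⟨a, ha⟩ := (mem_support_valueWeight f 0).1 (Finsupp.mem_support_iff.2 hw)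
  have := hf.1 a
  lia

/-- Two labeled posets are equivalent iff there is a weight-preserving bijection between their
partitions. -/
theorem kEq_iff_exists_equiv {α β : Type*} [PartialOrder α] [Fintype α] [PartialOrder β]
    [Fintype β] (ω : α → ℕ) (τ : β → ℕ) :
    KEq ω τ ↔ ∃ e : {f : α → ℕ // IsPtn ω f} ≃ {g : β → ℕ // IsPtn τ g},
      ∀ f, valueWeight (e f).1 = valueWeight f.1 := by
  constructor
  · intro h
    have key (w : ℕ →₀ ℕ) :
        Nonempty ({f : {f : α → ℕ // IsPtn ω f} // valueWeight f.1 = w} ≃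
          {g : {g : β → ℕ // IsPtn τ g} // valueWeight g.1 = w}) := by
      by_cases hw : w 0 = 0
      · have : Finite {f : {f : α → ℕ // IsPtn ω f} // valueWeight f.1 = w} :=
          ((finite_valueWeight_fiber w).preimage Subtype.val_injective.injOn).to_subtype
        have : Finite {g : {g : β → ℕ // IsPtn τ g} // valueWeight g.1 = w} :=
          ((finite_valueWeight_fiber w).preimage Subtype.val_injective.injOn).to_subtype
        refine Finite.card_eq.1 ?_
        rw [card_fiber_eq_ptnCount ω hw, card_fiber_eq_ptnCount τ hw, h w]
      · have := isEmpty_fiber ω hw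
        have := isEmpty_fiber τ hw
        exact ⟨Equiv.equivOfIsEmpty _ _⟩
    let e w := Classical.choice (key w)
    exact ⟨Equiv.ofFiberEquiv e, Equiv.ofFiberEquiv_map e⟩
  · rintro ⟨e, he⟩ w
    have hw : (w.erase 0) 0 = 0 := Finsupp.erase_same
    rw [← ptnCount_erase_zero ω, ← ptnCount_erase_zero τ, ← card_fiber_eq_ptnCount ω hw,
      ← card_fiber_eq_ptnCount τ hw]
    exact Nat.card_congr (e.subtypeEquiv fun f => by rw [he])

theorem isPtn_add_const {α : Type*} [PartialOrder α] (ω : α → ℕ) (c : ℕ) (f : α → ℕ) :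
    IsPtn (fun a => ω a + c) f ↔ IsPtn ω f := by
  simp [IsPtn]

theorem isPtn_sum {α β : Type*} [PartialOrder α] [PartialOrder β] (ω f : α ⊕ β → ℕ) :
    IsPtn ω f ↔ IsPtn (ω ∘ Sum.inl) (f ∘ Sum.inl) ∧ IsPtn (ω ∘ Sum.inr) (f ∘ Sum.inr) := by
  simp only [IsPtn, Sum.forall, Sum.inl_le_inl_iff, Sum.inr_le_inr_iff, Sum.not_inl_le_inr,
    Sum.not_inr_le_inl, Function.comp_apply, false_imp_iff, implies_true, and_true, true_and]
  tauto

theorem isPtn_sumLex {α β : Type*} [PartialOrder α] [PartialOrder β] (ω f : α ⊕ₗ β → ℕ) :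
    IsPtn ω f ↔
      IsPtn (fun a => ω (Sum.inlₗ a)) (fun a => f (Sum.inlₗ a)) ∧
      IsPtn (fun b => ω (Sum.inrₗ b)) (fun b => f (Sum.inrₗ b)) ∧
      ∀ a b, f (Sum.inlₗ a) ≤ f (Sum.inrₗ b) ∧
        (ω (Sum.inrₗ b) < ω (Sum.inlₗ a) → f (Sum.inlₗ a) < f (Sum.inrₗ b)) := by
  simp only [IsPtn, Lex.forall, Sum.forall, Sum.Lex.inl_le_inl_iff, Sum.Lex.inr_le_inr_iff,
    Sum.Lex.not_inr_le_inl, Sum.Lex.inl_le_inr, false_imp_iff, implies_true, and_true,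
    true_imp_iff, forall_and]
  tauto

/-- The conditions, in terms of the weights of its five restrictions, under which a map on
`BigPoset` respects the relations between different summands. -/
def WeightsCompatible (w₁ w₂ w₃ w₄ w₅ : ℕ →₀ ℕ) : Prop :=
  (∀ m ∈ w₄.support, (∀ n ∈ w₁.support, m ≤ n) ∧ (∀ n ∈ w₂.support, m ≤ n) ∧
    ∀ n ∈ w₃.support, m < n) ∧
  ∀ m ∈ w₅.support, (∀ n ∈ w₁.support, m < n) ∧ (∀ n ∈ w₂.support, m ≤ n) ∧
    ∀ n ∈ w₃.support, m < n

theorem IsLabeling.one_le_and_le_card {α : Type*} [Fintype α] {ω : α → ℕ} (h : IsLabeling ω)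
    (a : α) : 1 ≤ ω a ∧ ω a ≤ Fintype.card α := by
  simpa [Nat.card_eq_fintype_card] using h.mapsTo (Set.mem_univ a)

section BigPoset

variable {α₁ α₂ α₃ α₄ α₅ : Type*}

/-- The map on `BigPoset` with the given restrictions. -/
def glue (f₁ : α₁ → ℕ) (f₂ : α₂ → ℕ) (f₃ : α₃ → ℕ) (f₄ : α₄ → ℕ) (f₅ : α₅ → ℕ) :
    BigPoset α₁ α₂ α₃ α₄ α₅ → ℕ :=
  fun x => Sum.elim (Sum.elim f₄ f₅) (Sum.elim f₁ (Sum.elim f₂ f₃)) (ofLex x)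

theorem valueWeight_glue [Fintype α₁] [Fintype α₂] [Fintype α₃] [Fintype α₄] [Fintype α₅]
    (f₁ : α₁ → ℕ) (f₂ : α₂ → ℕ) (f₃ : α₃ → ℕ) (f₄ : α₄ → ℕ) (f₅ : α₅ → ℕ) :
    valueWeight (glue f₁ f₂ f₃ f₄ f₅) =
      (valueWeight f₄ + valueWeight f₅) +
        (valueWeight f₁ + (valueWeight f₂ + valueWeight f₃)) := by
  rw [valueWeight_sumLex, valueWeight_sum, valueWeight_sum (α := α₁),
    valueWeight_sum (α := α₂)]
  rfl

variable [PartialOrder α₁] [Fintype α₁] [PartialOrder α₂] [Fintype α₂] [PartialOrder α₃]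
  [Fintype α₃] [PartialOrder α₄] [Fintype α₄] [PartialOrder α₅] [Fintype α₅]
  {ω₁ : α₁ → ℕ} {ω₂ : α₂ → ℕ} {ω₃ : α₃ → ℕ} {ω₄ : α₄ → ℕ} {ω₅ : α₅ → ℕ}

theorem isPtn_glue (hω₁ : IsLabeling ω₁) (hω₂ : IsLabeling ω₂) (hω₃ : IsLabeling ω₃)
    (hω₄ : IsLabeling ω₄) (hω₅ : IsLabeling ω₅)
    (f₁ : α₁ → ℕ) (f₂ : α₂ → ℕ) (f₃ : α₃ → ℕ) (f₄ : α₄ → ℕ) (f₅ : α₅ → ℕ) :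
    IsPtn (bigLabel ω₁ ω₂ ω₃ ω₄ ω₅) (glue f₁ f₂ f₃ f₄ f₅) ↔
      (IsPtn ω₁ f₁ ∧ IsPtn ω₂ f₂ ∧ IsPtn ω₃ f₃ ∧ IsPtn ω₄ f₄ ∧ IsPtn ω₅ f₅) ∧
        WeightsCompatible (valueWeight f₁) (valueWeight f₂) (valueWeight f₃) (valueWeight f₄)
          (valueWeight f₅) := by
  have e₁ : IsPtn (fun a => ω₁ a + Fintype.card α₃ + Fintype.card α₄) f₁ ↔ IsPtn ω₁ f₁ := by
    simp only [add_assoc, isPtn_add_const]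
  have e₂ : IsPtn (fun a => ω₂ a + Fintype.card α₃ + Fintype.card α₄ + Fintype.card α₁ +
      Fintype.card α₅) f₂ ↔ IsPtn ω₂ f₂ := by
    simp only [add_assoc, isPtn_add_const]
  have e₅ : IsPtn (fun a => ω₅ a + Fintype.card α₃ + Fintype.card α₄ + Fintype.card α₁) f₅ ↔
      IsPtn ω₅ f₅ := by
    simp only [add_assoc, isPtn_add_const]
  have cross : (∀ a b, glue f₁ f₂ f₃ f₄ f₅ (Sum.inlₗ a) ≤ glue f₁ f₂ f₃ f₄ f₅ (Sum.inrₗ b) ∧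
      (bigLabel ω₁ ω₂ ω₃ ω₄ ω₅ (Sum.inrₗ b) < bigLabel ω₁ ω₂ ω₃ ω₄ ω₅ (Sum.inlₗ a) →
        glue f₁ f₂ f₃ f₄ f₅ (Sum.inlₗ a) < glue f₁ f₂ f₃ f₄ f₅ (Sum.inrₗ b))) ↔
      WeightsCompatible (valueWeight f₁) (valueWeight f₂) (valueWeight f₃) (valueWeight f₄)
        (valueWeight f₅) := by
    simp only [WeightsCompatible, mem_support_valueWeight, forall_exists_index,
      forall_apply_eq_imp_iff, Sum.forall, glue, bigLabel, Sum.inlₗ, Sum.inrₗ,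
      ofLex_toLex, Sum.elim_inl, Sum.elim_inr]
    have b₁ := hω₁.one_le_and_le_card
    have b₂ := hω₂.one_le_and_le_card
    have b₃ := hω₃.one_le_and_le_card
    have b₄ := hω₄.one_le_and_le_card
    have b₅ := hω₅.one_le_and_le_card
    refine and_congr (forall_congr' fun a => and_congr (forall_congr' fun b => ?_)
      (and_congr (forall_congr' fun b => ?_) (forall_congr' fun b => ?_)))
      (forall_congr' fun a => and_congr (forall_congr' fun b => ?_)
      (and_congr (forall_congr' fun b => ?_) (forall_congr' fun b => ?_)))
    · have := b₁ b; have := b₄ a; lia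
    · have := b₂ b; have := b₄ a; lia
    · have := b₃ b; have := b₄ a; lia
    · have := b₁ b; have := b₅ a; lia
    · have := b₂ b; have := b₅ a; lia
    · have := b₃ b; have := b₅ a; lia
  rw [isPtn_sumLex, cross, isPtn_sum, isPtn_sum (α := α₁), isPtn_sum (α := α₂), ← e₁, ← e₂,
    ← e₅, ← isPtn_add_const ω₄ (Fintype.card α₃) f₄]
  exact ⟨fun ⟨⟨h₄, h₅⟩, ⟨h₁, h₂, h₃⟩, h⟩ => ⟨⟨h₁, h₂, h₃, h₄, h₅⟩, h⟩,
    fun ⟨⟨h₁, h₂, h₃, h₄, h₅⟩, h⟩ => ⟨⟨h₄, h₅⟩, ⟨h₁, h₂, h₃⟩, h⟩⟩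

/-- Partitions of `BigPoset` are compatible tuples of partitions of the five summands. -/
noncomputable def glueEquiv (hω₁ : IsLabeling ω₁) (hω₂ : IsLabeling ω₂) (hω₃ : IsLabeling ω₃)
    (hω₄ : IsLabeling ω₄) (hω₅ : IsLabeling ω₅) :
    {p : {f // IsPtn ω₁ f} × {f // IsPtn ω₂ f} × {f // IsPtn ω₃ f} × {f // IsPtn ω₄ f} ×
        {f // IsPtn ω₅ f} //
      WeightsCompatible (valueWeight p.1.1) (valueWeight p.2.1.1) (valueWeight p.2.2.1.1)
        (valueWeight p.2.2.2.1.1) (valueWeight p.2.2.2.2.1)} ≃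
    {F // IsPtn (bigLabel ω₁ ω₂ ω₃ ω₄ ω₅) F} :=
  Equiv.ofBijective
    (fun p => ⟨glue p.1.1.1 p.1.2.1.1 p.1.2.2.1.1 p.1.2.2.2.1.1 p.1.2.2.2.2.1,
      (isPtn_glue hω₁ hω₂ hω₃ hω₄ hω₅ _ _ _ _ _).2
        ⟨⟨p.1.1.2, p.1.2.1.2, p.1.2.2.1.2, p.1.2.2.2.1.2, p.1.2.2.2.2.2⟩, p.2⟩⟩) <| by
    constructor
    · rintro ⟨⟨⟨f₁, _⟩, ⟨f₂, _⟩, ⟨f₃, _⟩, ⟨f₄, _⟩, ⟨f₅, _⟩⟩, _⟩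
        ⟨⟨⟨g₁, _⟩, ⟨g₂, _⟩, ⟨g₃, _⟩, ⟨g₄, _⟩, ⟨g₅, _⟩⟩, _⟩ h
      have h' : glue f₁ f₂ f₃ f₄ f₅ = glue g₁ g₂ g₃ g₄ g₅ := congrArg Subtype.val h
      obtain rfl : f₁ = g₁ := funext fun a => congrFun h' (Sum.inrₗ (Sum.inl a))
      obtain rfl : f₂ = g₂ := funext fun a => congrFun h' (Sum.inrₗ (Sum.inr (Sum.inl a)))
      obtain rfl : f₃ = g₃ := funext fun a => congrFun h' (Sum.inrₗ (Sum.inr (Sum.inr a)))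
      obtain rfl : f₄ = g₄ := funext fun a => congrFun h' (Sum.inlₗ (Sum.inl a))
      obtain rfl : f₅ = g₅ := funext fun a => congrFun h' (Sum.inlₗ (Sum.inr a))
      rfl
    · rintro ⟨F, hF⟩
      have hglue : glue (fun a => F (Sum.inrₗ (Sum.inl a)))
          (fun a => F (Sum.inrₗ (Sum.inr (Sum.inl a))))
          (fun a => F (Sum.inrₗ (Sum.inr (Sum.inr a)))) (fun a => F (Sum.inlₗ (Sum.inl a)))
          (fun a => F (Sum.inlₗ (Sum.inr a))) = F := by
        funext x
        rcases x with (_ | _) | _ | _ | _ <;> rfl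
      obtain ⟨⟨h₁, h₂, h₃, h₄, h₅⟩, h⟩ :=
        (isPtn_glue hω₁ hω₂ hω₃ hω₄ hω₅ _ _ _ _ _).1 (hglue.symm ▸ hF)
      exact ⟨⟨⟨⟨_, h₁⟩, ⟨_, h₂⟩, ⟨_, h₃⟩, ⟨_, h₄⟩, ⟨_, h₅⟩⟩, h⟩, Subtype.ext hglue⟩

theorem valueWeight_glueEquiv (hω₁ : IsLabeling ω₁) (hω₂ : IsLabeling ω₂)
    (hω₃ : IsLabeling ω₃) (hω₄ : IsLabeling ω₄) (hω₅ : IsLabeling ω₅) (p) :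
    valueWeight (glueEquiv hω₁ hω₂ hω₃ hω₄ hω₅ p).1 =
      (valueWeight p.1.2.2.2.1.1 + valueWeight p.1.2.2.2.2.1) +
        (valueWeight p.1.1.1 + (valueWeight p.1.2.1.1 + valueWeight p.1.2.2.1.1)) :=
  valueWeight_glue _ _ _ _ _

end BigPoset

/-- Theorem 5.1: if `(P_i,ω_i) ~ (Q_i,τ_i)` for `i = 1,…,5`, then the labeled posets `(P,ω)`
and `(Q,τ)` built from them as in Figure 7(a) satisfy `(P,ω) ~ (Q,τ)`. -/
theorem stmt14 {α₁ α₂ α₃ α₄ α₅ β₁ β₂ β₃ β₄ β₅ : Type*}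
    [PartialOrder α₁] [Fintype α₁] [PartialOrder α₂] [Fintype α₂]
    [PartialOrder α₃] [Fintype α₃] [PartialOrder α₄] [Fintype α₄]
    [PartialOrder α₅] [Fintype α₅]
    [PartialOrder β₁] [Fintype β₁] [PartialOrder β₂] [Fintype β₂]
    [PartialOrder β₃] [Fintype β₃] [PartialOrder β₄] [Fintype β₄]
    [PartialOrder β₅] [Fintype β₅]
    (ω₁ : α₁ → ℕ) (ω₂ : α₂ → ℕ) (ω₃ : α₃ → ℕ) (ω₄ : α₄ → ℕ) (ω₅ : α₅ → ℕ)
    (τ₁ : β₁ → ℕ) (τ₂ : β₂ → ℕ) (τ₃ : β₃ → ℕ) (τ₄ : β₄ → ℕ) (τ₅ : β₅ → ℕ)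
    (hω₁ : IsLabeling ω₁) (hω₂ : IsLabeling ω₂) (hω₃ : IsLabeling ω₃)
    (hω₄ : IsLabeling ω₄) (hω₅ : IsLabeling ω₅)
    (hτ₁ : IsLabeling τ₁) (hτ₂ : IsLabeling τ₂) (hτ₃ : IsLabeling τ₃)
    (hτ₄ : IsLabeling τ₄) (hτ₅ : IsLabeling τ₅)
    (h₁ : KEq ω₁ τ₁) (h₂ : KEq ω₂ τ₂) (h₃ : KEq ω₃ τ₃) (h₄ : KEq ω₄ τ₄) (h₅ : KEq ω₅ τ₅) :
    KEq (bigLabel ω₁ ω₂ ω₃ ω₄ ω₅) (bigLabel τ₁ τ₂ τ₃ τ₄ τ₅) := by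
  obtain ⟨e₁, he₁⟩ := (kEq_iff_exists_equiv _ _).1 h₁
  obtain ⟨e₂, he₂⟩ := (kEq_iff_exists_equiv _ _).1 h₂
  obtain ⟨e₃, he₃⟩ := (kEq_iff_exists_equiv _ _).1 h₃
  obtain ⟨e₄, he₄⟩ := (kEq_iff_exists_equiv _ _).1 h₄
  obtain ⟨e₅, he₅⟩ := (kEq_iff_exists_equiv _ _).1 h₅
  let e := e₁.prodCongr (e₂.prodCongr (e₃.prodCongr (e₄.prodCongr e₅)))
  refine (kEq_iff_exists_equiv _ _).2 ⟨(glueEquiv hω₁ hω₂ hω₃ hω₄ hω₅).symm.trans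
    ((e.subtypeEquiv fun p => ?_).trans (glueEquiv hτ₁ hτ₂ hτ₃ hτ₄ hτ₅)), fun F => ?_⟩
  · simp [e, he₁, he₂, he₃, he₄, he₅]
  · obtain ⟨p, rfl⟩ := (glueEquiv hω₁ hω₂ hω₃ hω₄ hω₅).surjective F
    simp [valueWeight_glueEquiv, e, he₁, he₂, he₃, he₄, he₅]
end

section
/- Suppose the labeled poset (P₁,ω₁) has a unique minimal element p₁ and the labeled poset (P₂,ω₂) has a unique maximal element p₂. Then for every weight α: the number of ((P₁,ω₁)+(P₂,ω₂))-partitions of weight α equals the number of (P₂ ⇑ P₁)-partitions of weight α plus the number of (P₁ ↗ P₂)-partitions of weight α; and it also equals the number of (P₂ ↑ P₁)-partitions of weight α plus the number of (P₁ ⇗ P₂)-partitions of weight α. (Equivalently, K_{(P₁,ω₁)+(P₂,ω₂)} = K_{P₂⇑P₁} + K_{P₁↗P₂} = K_{P₂↑P₁} + K_{P₁⇗P₂}.) -/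
/-- `f` is a partition for the order relation `r` and labeling `ω`: order-preserving along
`r`, strictly so along pairs whose labels decrease. -/
def IsPtnRel {γ : Type*} (r : γ → γ → Prop) (ω : γ → ℕ) (f : γ → ℕ) : Prop :=
  (∀ a, 1 ≤ f a) ∧ (∀ a b : γ, r a b → f a ≤ f b) ∧
    (∀ a b : γ, r a b → ω b < ω a → f a < f b)

/-- The number of partitions (w.r.t. order relation `r` and labeling `ω`) of weight `w`. -/
noncomputable def ptnCountRel {γ : Type*} (r : γ → γ → Prop) (ω : γ → ℕ) (w : ℕ →₀ ℕ) : ℕ :=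
  Set.ncard {f : γ → ℕ | IsPtnRel r ω f ∧ ∀ m : ℕ, 1 ≤ m → (f ⁻¹' {m}).ncard = w m}

section Rels

variable {α β : Type*} [PartialOrder α] [PartialOrder β]

/-- The disjoint-union order on `P₁ ⊔ P₂` (no relations between the summands). -/
def duRel : α ⊕ β → α ⊕ β → Prop
  | Sum.inl a, Sum.inl a' => a ≤ a'
  | Sum.inr b, Sum.inr b' => b ≤ b'
  | _, _ => False

/-- The ordinal-sum order on `P₁ ⊔ P₂` with all of `P₂` below all of `P₁`
(used for `P₂ ⇑ P₁` and `P₂ ↑ P₁`). -/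
def ordSumRel : α ⊕ β → α ⊕ β → Prop
  | Sum.inl a, Sum.inl a' => a ≤ a'
  | Sum.inr b, Sum.inr b' => b ≤ b'
  | Sum.inr _, Sum.inl _ => True
  | Sum.inl _, Sum.inr _ => False

/-- The order on `P₁ ⊔ P₂` generated by the orders of `P₁` and `P₂` together with the single
relation `p₁ < p₂`, where `p₁` is the (unique) minimal element of `P₁` and `p₂` is the
(unique) maximal element of `P₂` (used for `P₁ ↗ P₂` and `P₁ ⇗ P₂`). -/
def arrowRel (p₁ : α) (p₂ : β) : α ⊕ β → α ⊕ β → Prop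
  | Sum.inl a, Sum.inl a' => a ≤ a'
  | Sum.inr b, Sum.inr b' => b ≤ b'
  | Sum.inl a, Sum.inr b => a ≤ p₁ ∧ p₂ ≤ b
  | Sum.inr _, Sum.inl _ => False

end Rels

theorem le_of_unique_isMin {α : Type*} [PartialOrder α] [Finite α] {p : α}
    (hp : ∀ a : α, IsMin a → a = p) (a : α) : p ≤ a := by
  obtain ⟨m, hma, hm⟩ := Set.finite_univ.exists_le_minimal (Set.mem_univ a)
  have hmin : IsMin m := fun b hb => hm.2 (Set.mem_univ b) hb
  exact hp m hmin ▸ hma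

theorem le_of_unique_isMax {α : Type*} [PartialOrder α] [Finite α] {p : α}
    (hp : ∀ a : α, IsMax a → a = p) (a : α) : a ≤ p :=
  le_of_unique_isMin (α := αᵒᵈ) (p := OrderDual.toDual p) (fun b hb => hp b hb) a

/-- Finitely many positive functions on a finite type have a given weight. -/
theorem finite_setOf_weight {γ : Type*} [Finite γ] (w : ℕ →₀ ℕ) :
    {f : γ → ℕ | (∀ a, 1 ≤ f a) ∧
      ∀ m : ℕ, 1 ≤ m → (f ⁻¹' {m}).ncard = w m}.Finite := by
  refine (Set.Finite.pi' fun _ : γ => w.support.finite_toSet).subset ?_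
  rintro f ⟨hpos, hw⟩ a
  have hne : (f ⁻¹' {f a}).ncard ≠ 0 := Set.ncard_ne_zero_of_mem (a := a) rfl
  simpa [← hw (f a) (hpos a)] using hne

/-- If the partitions for `(r, ω)` are split by a predicate into those for `(r₁, ω₁)` and
those for `(r₂, ω₂)`, the counts add up. -/
theorem ptnCountRel_eq_add {γ : Type*} [Finite γ] {r r₁ r₂ : γ → γ → Prop}
    {ω ω₁ ω₂ : γ → ℕ} (Q : (γ → ℕ) → Prop)
    (h₁ : ∀ f, IsPtnRel r₁ ω₁ f ↔ IsPtnRel r ω f ∧ Q f)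
    (h₂ : ∀ f, IsPtnRel r₂ ω₂ f ↔ IsPtnRel r ω f ∧ ¬ Q f) (w : ℕ →₀ ℕ) :
    ptnCountRel r ω w = ptnCountRel r₁ ω₁ w + ptnCountRel r₂ ω₂ w := by
  unfold ptnCountRel
  rw [← Set.ncard_union_eq ?_ ?_ ?_]
  · congr 1
    ext f
    simp only [Set.mem_ofPred_eq, Set.mem_union, h₁, h₂]
    tauto
  · refine Set.disjoint_left.2 fun f hf hf' => ?_
    exact ((h₂ f).1 hf'.1).2 ((h₁ f).1 hf.1).2
  · exact (finite_setOf_weight w).subset fun f hf => ⟨hf.1.1, hf.2⟩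
  · exact (finite_setOf_weight w).subset fun f hf => ⟨hf.1.1, hf.2⟩

section SumPartitions

variable {α β : Type*} [PartialOrder α] [PartialOrder β] {ω₁ : α → ℕ} {ω₂ : β → ℕ}
  {f : α ⊕ β → ℕ}

theorem isPtnRel_duRel_iff {ω : α ⊕ β → ℕ} :
    IsPtnRel duRel ω f ↔
      IsPtnRel (· ≤ ·) (ω ∘ Sum.inl) (f ∘ Sum.inl) ∧
        IsPtnRel (· ≤ ·) (ω ∘ Sum.inr) (f ∘ Sum.inr) := by
  simp only [IsPtnRel, duRel, Sum.forall, Function.comp_apply, forall_and,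
    false_imp_iff, implies_true]
  tauto

theorem isPtnRel_ordSumRel_iff {ω : α ⊕ β → ℕ} :
    IsPtnRel ordSumRel ω f ↔ IsPtnRel duRel ω f ∧
      ∀ b a, f (Sum.inr b) ≤ f (Sum.inl a) ∧
        (ω (Sum.inl a) < ω (Sum.inr b) → f (Sum.inr b) < f (Sum.inl a)) := by
  simp only [IsPtnRel, duRel, ordSumRel, Sum.forall, forall_and,
    false_imp_iff, true_imp_iff, implies_true]
  tauto

theorem isPtnRel_arrowRel_iff {p₁ : α} {p₂ : β} (hp₁ : ∀ a, p₁ ≤ a) (hp₂ : ∀ b, b ≤ p₂)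
    {ω : α ⊕ β → ℕ} :
    IsPtnRel (arrowRel p₁ p₂) ω f ↔ IsPtnRel duRel ω f ∧
      f (Sum.inl p₁) ≤ f (Sum.inr p₂) ∧
        (ω (Sum.inr p₂) < ω (Sum.inl p₁) → f (Sum.inl p₁) < f (Sum.inr p₂)) := by
  have hl : ∀ a, a ≤ p₁ ↔ a = p₁ := fun a => ⟨fun h => h.antisymm (hp₁ a), fun h => h.le⟩
  have hr : ∀ b, p₂ ≤ b ↔ b = p₂ := fun b => ⟨fun h => (hp₂ b).antisymm h, fun h => h.ge⟩
  simp only [IsPtnRel, duRel, arrowRel, Sum.forall, hl, hr, forall_and,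
    false_imp_iff, implies_true, and_imp, forall_eq, forall_eq_apply_imp_iff]
  grind

theorem isPtnRel_duRel_shift_iff (m n : ℕ) :
    IsPtnRel duRel (Sum.elim (fun a => ω₁ a + n) ω₂) f ↔
      IsPtnRel duRel (Sum.elim ω₁ fun b => ω₂ b + m) f := by
  rw [isPtnRel_duRel_iff, isPtnRel_duRel_iff]
  simp [IsPtnRel]

theorem IsPtnRel.le_inl {p₁ : α} (hp₁ : ∀ a, p₁ ≤ a) {ω : α ⊕ β → ℕ}
    (hf : IsPtnRel duRel ω f) (a : α) : f (Sum.inl p₁) ≤ f (Sum.inl a) :=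
  hf.2.1 (Sum.inl p₁) (Sum.inl a) (hp₁ a)

theorem IsPtnRel.inr_le {p₂ : β} (hp₂ : ∀ b, b ≤ p₂) {ω : α ⊕ β → ℕ}
    (hf : IsPtnRel duRel ω f) (b : β) : f (Sum.inr b) ≤ f (Sum.inr p₂) :=
  hf.2.1 (Sum.inr b) (Sum.inr p₂) (hp₂ b)

end SumPartitions

theorem IsLabeling.pos {α : Type*} {ω : α → ℕ} (h : IsLabeling ω) (a : α) : 0 < ω a :=
  (h.mapsTo (Set.mem_univ a)).1

theorem IsLabeling.le_card {α : Type*} [Fintype α] {ω : α → ℕ} (h : IsLabeling ω) (a : α) :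
    ω a ≤ Fintype.card α :=
  Nat.card_eq_fintype_card (α := α) ▸ (h.mapsTo (Set.mem_univ a)).2

/-- Lemma 5.5: if `(P₁,ω₁)` has a unique minimal element `p₁` and `(P₂,ω₂)` has a unique
maximal element `p₂`, then for every weight `w`,
`K_{(P₁,ω₁)+(P₂,ω₂)} = K_{P₂⇑P₁} + K_{P₁↗P₂}` and
`K_{(P₁,ω₁)+(P₂,ω₂)} = K_{P₂↑P₁} + K_{P₁⇗P₂}`. -/
theorem stmt15 {α β : Type*} [PartialOrder α] [Fintype α] [PartialOrder β] [Fintype β]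
    (ω₁ : α → ℕ) (ω₂ : β → ℕ) (hω₁ : IsLabeling ω₁) (hω₂ : IsLabeling ω₂)
    (p₁ : α) (hp₁ : IsMin p₁) (hp₁u : ∀ a : α, IsMin a → a = p₁)
    (p₂ : β) (hp₂ : IsMax p₂) (hp₂u : ∀ b : β, IsMax b → b = p₂)
    (w : ℕ →₀ ℕ) :
    (ptnCountRel duRel (Sum.elim ω₁ fun b => ω₂ b + Fintype.card α) w =
      ptnCountRel ordSumRel (Sum.elim ω₁ fun b => ω₂ b + Fintype.card α) w +
      ptnCountRel (arrowRel p₁ p₂) (Sum.elim ω₁ fun b => ω₂ b + Fintype.card α) w) ∧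
    (ptnCountRel duRel (Sum.elim ω₁ fun b => ω₂ b + Fintype.card α) w =
      ptnCountRel ordSumRel (Sum.elim (fun a => ω₁ a + Fintype.card β) ω₂) w +
      ptnCountRel (arrowRel p₁ p₂) (Sum.elim (fun a => ω₁ a + Fintype.card β) ω₂) w) := by
  have h₁ := le_of_unique_isMin hp₁u
  have h₂ := le_of_unique_isMax hp₂u
  constructor
  · have hlt (a : α) (b : β) : ω₁ a < ω₂ b + Fintype.card α := by
      have := hω₁.le_card a
      have := hω₂.pos b
      omega
    refine ptnCountRel_eq_add (fun f => f (Sum.inr p₂) < f (Sum.inl p₁)) ?_ ?_ w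
    · intro f
      rw [isPtnRel_ordSumRel_iff]
      refine and_congr_right fun hf => ⟨fun h => (h p₂ p₁).2 (hlt p₁ p₂), fun h b a => ?_⟩
      have hab := ((hf.inr_le h₂ b).trans_lt h).trans_le (hf.le_inl h₁ a)
      exact ⟨hab.le, fun _ => hab⟩
    · intro f
      rw [isPtnRel_arrowRel_iff h₁ h₂]
      simp [(hlt p₁ p₂).not_gt]
  · have hlt (a : α) (b : β) : ω₂ b < ω₁ a + Fintype.card β := by
      have := hω₂.le_card b
      have := hω₁.pos a
      omega
    refine ptnCountRel_eq_add (fun f => f (Sum.inr p₂) ≤ f (Sum.inl p₁)) ?_ ?_ w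
    · intro f
      rw [isPtnRel_ordSumRel_iff, isPtnRel_duRel_shift_iff (Fintype.card α)]
      refine and_congr_right fun hf => ⟨fun h => (h p₂ p₁).1, fun h b a => ?_⟩
      exact ⟨((hf.inr_le h₂ b).trans h).trans (hf.le_inl h₁ a),
        fun hab => absurd hab (hlt a b).not_gt⟩
    · intro f
      rw [isPtnRel_arrowRel_iff h₁ h₂, isPtnRel_duRel_shift_iff (Fintype.card α)]
      simp only [Sum.elim_inl, Sum.elim_inr, hlt p₁ p₂, true_imp_iff, not_le]
      exact and_congr_right fun _ => ⟨fun h => h.2, fun h => ⟨h.le, h⟩⟩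
end

section
/- Suppose labeled posets (P₁,ω₁), (P₂,ω₂), (Q₁,τ₁), (Q₂,τ₂) each have a unique minimal element and a unique maximal element, and suppose (P₁,ω₁) ~ (Q₁,τ₁) and (P₂,ω₂) ~ (Q₂,τ₂). Then for each of the five choices (ε,δ) ∈ {(weak,none), (strict,none), (weak,weak), (strict,strict), (weak,strict)} and for every weight α, the number of (P₁ ∘_{ε,δ} P₂)-partitions of weight α equals the number of (Q₁ ∘_{ε,δ} Q₂)-partitions of weight α. In particular the operations ↗, ⇗, ↗↖, ⇗⇖ and ↗⇖ of joining two labeled posets by edges between the minimum of one and the maximum of the other all preserve equality of generating functions. -/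
/-- The kind of an extra edge joining two labeled posets: weak, strict, or absent. -/
inductive EdgeKind : Type
  | weak : EdgeKind
  | strict : EdgeKind
  | none : EdgeKind

/-- The condition imposed on the values of a partition across an extra edge. -/
def edgeCond : EdgeKind → ℕ → ℕ → Prop
  | EdgeKind.weak, x, y => x ≤ y
  | EdgeKind.strict, x, y => x < y
  | EdgeKind.none, _, _ => True

/-- The number of `(P₁ ∘_{ε,δ} P₂)`-partitions of weight `w`: maps `f : P₁ ⊔ P₂ → ℙ`
restricting to a `(P₁,ω₁)`-partition and a `(P₂,ω₂)`-partition, with the condition `ε`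
relating `f(b₁)` and `f(t₂)` and the condition `δ` relating `f(b₂)` and `f(t₁)`, where
`b_i` and `t_i` denote the minimum and maximum of `P_i`. -/
noncomputable def combCount {α β : Type*} [PartialOrder α] [PartialOrder β]
    (ω₁ : α → ℕ) (ω₂ : β → ℕ) (b₁ t₁ : α) (b₂ t₂ : β) (ε δ : EdgeKind) (w : ℕ →₀ ℕ) : ℕ :=
  Set.ncard {f : α ⊕ β → ℕ |
    IsPtn ω₁ (fun a => f (Sum.inl a)) ∧ IsPtn ω₂ (fun b => f (Sum.inr b)) ∧
    edgeCond ε (f (Sum.inl b₁)) (f (Sum.inr t₂)) ∧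
    edgeCond δ (f (Sum.inr b₂)) (f (Sum.inl t₁)) ∧
    ∀ m : ℕ, 1 ≤ m → (f ⁻¹' {m}).ncard = w m}

/-- The weight of a map: the size of each of its fibres. -/
noncomputable def fibreWeight {α : Type*} [Finite α] (f : α → ℕ) : ℕ →₀ ℕ :=
  Finsupp.ofSupportFinite (fun m => (f ⁻¹' {m}).ncard) <| by
    refine (Set.finite_range f).subset fun m hm => ?_
    obtain ⟨a, ha⟩ := Set.nonempty_of_ncard_ne_zero hm
    exact ⟨a, ha⟩

theorem fibreWeight_apply {α : Type*} [Finite α] (f : α → ℕ) (m : ℕ) :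
    fibreWeight f m = (f ⁻¹' {m}).ncard := rfl

theorem fibreWeight_ne_zero_iff {α : Type*} [Finite α] (f : α → ℕ) (m : ℕ) :
    fibreWeight f m ≠ 0 ↔ m ∈ Set.range f := by
  rw [fibreWeight_apply, ← Nat.pos_iff_ne_zero, Set.ncard_pos]
  rfl

theorem finite_fibreWeight_eq {α : Type*} [Finite α] (w : ℕ →₀ ℕ) :
    {f : α → ℕ | fibreWeight f = w}.Finite := by
  refine (Set.Finite.pi' fun _ : α => w.support.finite_toSet).subset ?_
  rintro f rfl a
  simpa using (fibreWeight_ne_zero_iff f (f a)).2 ⟨a, rfl⟩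

theorem IsPtn.fibreWeight_zero {α : Type*} [Finite α] [PartialOrder α] {ω f : α → ℕ}
    (hf : IsPtn ω f) : fibreWeight f 0 = 0 := by
  by_contra h
  obtain ⟨a, ha⟩ := (fibreWeight_ne_zero_iff f 0).1 h
  have := hf.1 a
  omega

theorem ncard_fibreWeight_eq {α : Type*} [Finite α] [PartialOrder α] (ω : α → ℕ)
    {w : ℕ →₀ ℕ} (hw : w 0 = 0) :
    {f : α → ℕ | IsPtn ω f ∧ fibreWeight f = w}.ncard = ptnCount ω w := by
  refine congrArg Set.ncard (Set.ext fun f => and_congr_right fun hf => ⟨?_, fun h => ?_⟩)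
  · rintro rfl m -
    rfl
  · ext m
    rcases Nat.eq_zero_or_pos m with rfl | hm
    · rw [hf.fibreWeight_zero, hw]
    · exact h m hm

/-- Equality of generating functions gives a weight-preserving bijection of partitions. -/
theorem KEq.exists_equiv {α β : Type*} [Finite α] [Finite β] [PartialOrder α] [PartialOrder β]
    {ω : α → ℕ} {τ : β → ℕ} (h : KEq ω τ) :
    ∃ e : {f // IsPtn ω f} ≃ {g // IsPtn τ g}, ∀ f, fibreWeight (e f).1 = fibreWeight f.1 := by
  have key (w : ℕ →₀ ℕ) : Nonempty ({f : {f // IsPtn ω f} // fibreWeight f.1 = w} ≃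
      {g : {g // IsPtn τ g} // fibreWeight g.1 = w}) := by
    by_cases hw : w 0 = 0
    · have : Finite {f : α → ℕ | IsPtn ω f ∧ fibreWeight f = w} :=
        (finite_fibreWeight_eq w).subset fun f hf => hf.2
      have : Finite {g : β → ℕ | IsPtn τ g ∧ fibreWeight g = w} :=
        (finite_fibreWeight_eq w).subset fun g hg => hg.2
      have hc := ((ncard_fibreWeight_eq ω hw).trans (h w)).trans (ncard_fibreWeight_eq τ hw).symm
      obtain ⟨E⟩ := Finite.card_eq.1 hc
      exact ⟨(Equiv.subtypeSubtypeEquivSubtypeInter _ (fun f => fibreWeight f = w)).trans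
        (E.trans
          (Equiv.subtypeSubtypeEquivSubtypeInter _ (fun g => fibreWeight g = w)).symm)⟩
    · have : IsEmpty {f : {f // IsPtn ω f} // fibreWeight f.1 = w} :=
        ⟨fun f => hw (f.2 ▸ f.1.2.fibreWeight_zero)⟩
      have : IsEmpty {g : {g // IsPtn τ g} // fibreWeight g.1 = w} :=
        ⟨fun g => hw (g.2 ▸ g.1.2.fibreWeight_zero)⟩
      exact ⟨Equiv.equivOfIsEmpty _ _⟩
  obtain ⟨E⟩ := Classical.nonempty_pi.2 key
  refine ⟨(Equiv.sigmaFiberEquiv fun f : {f // IsPtn ω f} => fibreWeight f.1).symm.trans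
    ((Equiv.sigmaCongrRight E).trans (Equiv.sigmaFiberEquiv _)), fun f => ?_⟩
  exact (E (fibreWeight f.1) ⟨f, rfl⟩).2

theorem range_eq_of_fibreWeight_eq {α β : Type*} [Finite α] [Finite β] {f : α → ℕ} {g : β → ℕ}
    (h : fibreWeight f = fibreWeight g) : Set.range f = Set.range g := by
  ext m
  rw [← fibreWeight_ne_zero_iff, ← fibreWeight_ne_zero_iff, h]

theorem isLeast_range_of_unique_isMin {α : Type*} [Finite α] [PartialOrder α] {b : α}
    (hb : ∀ a, IsMin a → a = b) {f : α → ℕ} (hf : Monotone f) :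
    IsLeast (Set.range f) (f b) := by
  refine ⟨⟨b, rfl⟩, ?_⟩
  rintro _ ⟨a, rfl⟩
  obtain ⟨c, hca, hc⟩ := Finite.exists_le_minimal (p := fun _ : α => True) (a := a) trivial
  exact hf (hb c (minimal_true.1 hc) ▸ hca)

theorem isGreatest_range_of_unique_isMax {α : Type*} [Finite α] [PartialOrder α] {t : α}
    (ht : ∀ a, IsMax a → a = t) {f : α → ℕ} (hf : Monotone f) :
    IsGreatest (Set.range f) (f t) := by
  refine ⟨⟨t, rfl⟩, ?_⟩
  rintro _ ⟨a, rfl⟩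
  obtain ⟨c, hac, hc⟩ := Finite.exists_le_maximal (p := fun _ : α => True) (a := a) trivial
  exact hf (ht c (maximal_true.1 hc) ▸ hac)

theorem ncard_preimage_sum {α β γ : Type*} [Finite α] [Finite β] (f : α ⊕ β → γ) (s : Set γ) :
    (f ⁻¹' s).ncard =
      ((fun a => f (Sum.inl a)) ⁻¹' s).ncard + ((fun b => f (Sum.inr b)) ⁻¹' s).ncard := by
  simp only [← Nat.card_coe_set_eq]
  rw [← Nat.card_sum]
  exact Nat.card_congr Equiv.subtypeSum

/-- Joining by any two kinds of edges preserves equality of generating functions, since the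
values of a partition at the minimum and at the maximum are determined by its weight. -/
theorem KEq.combCount_eq {α₁ α₂ β₁ β₂ : Type*}
    [PartialOrder α₁] [Finite α₁] [PartialOrder α₂] [Finite α₂]
    [PartialOrder β₁] [Finite β₁] [PartialOrder β₂] [Finite β₂]
    {ω₁ : α₁ → ℕ} {ω₂ : α₂ → ℕ} {τ₁ : β₁ → ℕ} {τ₂ : β₂ → ℕ}
    (h₁ : KEq ω₁ τ₁) (h₂ : KEq ω₂ τ₂)
    {b₁ t₁ : α₁} (hb₁ : ∀ a, IsMin a → a = b₁) (ht₁ : ∀ a, IsMax a → a = t₁)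
    {b₂ t₂ : α₂} (hb₂ : ∀ a, IsMin a → a = b₂) (ht₂ : ∀ a, IsMax a → a = t₂)
    {c₁ u₁ : β₁} (hc₁ : ∀ a, IsMin a → a = c₁) (hu₁ : ∀ a, IsMax a → a = u₁)
    {c₂ u₂ : β₂} (hc₂ : ∀ a, IsMin a → a = c₂) (hu₂ : ∀ a, IsMax a → a = u₂)
    (ε δ : EdgeKind) (w : ℕ →₀ ℕ) :
    combCount ω₁ ω₂ b₁ t₁ b₂ t₂ ε δ w = combCount τ₁ τ₂ c₁ u₁ c₂ u₂ ε δ w := by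
  obtain ⟨e₁, he₁⟩ := h₁.exists_equiv
  obtain ⟨e₂, he₂⟩ := h₂.exists_equiv
  have bot₁ (f) : (e₁ f).1 c₁ = f.1 b₁ :=
    (isLeast_range_of_unique_isMin hc₁ (e₁ f).2.2.1).unique
      (range_eq_of_fibreWeight_eq (he₁ f) ▸ isLeast_range_of_unique_isMin hb₁ f.2.2.1)
  have bot₂ (f) : (e₂ f).1 c₂ = f.1 b₂ :=
    (isLeast_range_of_unique_isMin hc₂ (e₂ f).2.2.1).unique
      (range_eq_of_fibreWeight_eq (he₂ f) ▸ isLeast_range_of_unique_isMin hb₂ f.2.2.1)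
  have top₁ (f) : (e₁ f).1 u₁ = f.1 t₁ :=
    (isGreatest_range_of_unique_isMax hu₁ (e₁ f).2.2.1).unique
      (range_eq_of_fibreWeight_eq (he₁ f) ▸ isGreatest_range_of_unique_isMax ht₁ f.2.2.1)
  have top₂ (f) : (e₂ f).1 u₂ = f.1 t₂ :=
    (isGreatest_range_of_unique_isMax hu₂ (e₂ f).2.2.1).unique
      (range_eq_of_fibreWeight_eq (he₂ f) ▸ isGreatest_range_of_unique_isMax ht₂ f.2.2.1)
  have wt₁ (f m) : ((e₁ f).1 ⁻¹' {m}).ncard = (f.1 ⁻¹' {m}).ncard := DFunLike.congr_fun (he₁ f) m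
  have wt₂ (f m) : ((e₂ f).1 ⁻¹' {m}).ncard = (f.1 ⁻¹' {m}).ncard := DFunLike.congr_fun (he₂ f) m
  refine Set.ncard_congr
    (fun f hf => Sum.elim (e₁ ⟨_, hf.1⟩).1 (e₂ ⟨_, hf.2.1⟩).1) ?_ ?_ ?_
  · rintro f ⟨hf₁, hf₂, hε, hδ, hw⟩
    refine ⟨(e₁ ⟨_, hf₁⟩).2, (e₂ ⟨_, hf₂⟩).2, ?_, ?_, fun m hm => ?_⟩
    · simpa only [Sum.elim_inl, Sum.elim_inr, bot₁, top₂] using hε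
    · simpa only [Sum.elim_inl, Sum.elim_inr, bot₂, top₁] using hδ
    · rw [← hw m hm, ncard_preimage_sum, ncard_preimage_sum f]
      exact congrArg₂ _ (wt₁ ⟨_, hf₁⟩ m) (wt₂ ⟨_, hf₂⟩ m)
  · intro f g hf hg hfg
    have h₁ := e₁.injective (Subtype.ext (congrArg (fun k => k ∘ Sum.inl) hfg))
    have h₂ := e₂.injective (Subtype.ext (congrArg (fun k => k ∘ Sum.inr) hfg))
    ext (a | b)
    · exact congrFun (congrArg Subtype.val h₁) a
    · exact congrFun (congrArg Subtype.val h₂) b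
  · rintro g ⟨hg₁, hg₂, hε, hδ, hw⟩
    obtain ⟨⟨f₁, hf₁⟩, h₁⟩ := e₁.surjective ⟨_, hg₁⟩
    obtain ⟨⟨f₂, hf₂⟩, h₂⟩ := e₂.surjective ⟨_, hg₂⟩
    have hb₁ := bot₁ ⟨f₁, hf₁⟩
    have ht₁ := top₁ ⟨f₁, hf₁⟩
    have hb₂ := bot₂ ⟨f₂, hf₂⟩
    have ht₂ := top₂ ⟨f₂, hf₂⟩
    have hw₁ := wt₁ ⟨f₁, hf₁⟩
    have hw₂ := wt₂ ⟨f₂, hf₂⟩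
    simp only [h₁, h₂] at hb₁ ht₁ hb₂ ht₂ hw₁ hw₂
    refine ⟨Sum.elim f₁ f₂, ⟨hf₁, hf₂, ?_, ?_, fun m hm => ?_⟩, ?_⟩
    · simpa only [Sum.elim_inl, Sum.elim_inr, ← hb₁, ← ht₂] using hε
    · simpa only [Sum.elim_inl, Sum.elim_inr, ← hb₂, ← ht₁] using hδ
    · rw [← hw m hm, ncard_preimage_sum, ncard_preimage_sum g, hw₁, hw₂]
      rfl
    · simp only [Sum.elim_inl, Sum.elim_inr, h₁, h₂]
      exact Sum.elim_comp_inl_inr g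

/-- Theorem 5.9: the five ways `↗`, `⇗`, `↗↖`, `⇗⇖`, `↗⇖` of joining two labeled posets,
each having a unique minimal and a unique maximal element, by edges between the minimum of
one and the maximum of the other, all preserve equality of generating functions. -/
theorem stmt16 {α₁ α₂ β₁ β₂ : Type*}
    [PartialOrder α₁] [Fintype α₁] [PartialOrder α₂] [Fintype α₂]
    [PartialOrder β₁] [Fintype β₁] [PartialOrder β₂] [Fintype β₂]
    (ω₁ : α₁ → ℕ) (ω₂ : α₂ → ℕ) (τ₁ : β₁ → ℕ) (τ₂ : β₂ → ℕ)
    (hω₁ : IsLabeling ω₁) (hω₂ : IsLabeling ω₂) (hτ₁ : IsLabeling τ₁) (hτ₂ : IsLabeling τ₂)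
    (b₁ t₁ : α₁) (hb₁ : IsMin b₁) (hb₁u : ∀ a : α₁, IsMin a → a = b₁)
    (ht₁ : IsMax t₁) (ht₁u : ∀ a : α₁, IsMax a → a = t₁)
    (b₂ t₂ : α₂) (hb₂ : IsMin b₂) (hb₂u : ∀ a : α₂, IsMin a → a = b₂)
    (ht₂ : IsMax t₂) (ht₂u : ∀ a : α₂, IsMax a → a = t₂)
    (c₁ u₁ : β₁) (hc₁ : IsMin c₁) (hc₁u : ∀ a : β₁, IsMin a → a = c₁)
    (hu₁ : IsMax u₁) (hu₁u : ∀ a : β₁, IsMax a → a = u₁)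
    (c₂ u₂ : β₂) (hc₂ : IsMin c₂) (hc₂u : ∀ a : β₂, IsMin a → a = c₂)
    (hu₂ : IsMax u₂) (hu₂u : ∀ a : β₂, IsMax a → a = u₂)
    (h₁ : KEq ω₁ τ₁) (h₂ : KEq ω₂ τ₂) :
    ∀ ε δ : EdgeKind,
      (ε, δ) ∈ ([(EdgeKind.weak, EdgeKind.none), (EdgeKind.strict, EdgeKind.none),
        (EdgeKind.weak, EdgeKind.weak), (EdgeKind.strict, EdgeKind.strict),
        (EdgeKind.weak, EdgeKind.strict)] : List (EdgeKind × EdgeKind)) →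
      ∀ w : ℕ →₀ ℕ,
        combCount ω₁ ω₂ b₁ t₁ b₂ t₂ ε δ w = combCount τ₁ τ₂ c₁ u₁ c₂ u₂ ε δ w := by
  exact fun ε δ _ w => h₁.combCount_eq h₂ hb₁u ht₁u hb₂u ht₂u hc₁u hu₁u hc₂u hu₂u ε δ w
end

section
/- Let P be a finite poset. (a) P has exactly 2 linear extensions if and only if P is order-isomorphic to an ordinal sum C₁ ⊕ A ⊕ C₂, where C₁ and C₂ are (possibly empty) chains and A is a 2-element antichain. (b) P has exactly 3 linear extensions if and only if P is order-isomorphic to an ordinal sum C₁ ⊕ A ⊕ C₂, where C₁ and C₂ are (possibly empty) chains and A is the 3-element poset consisting of a 2-element chain together with a third element incomparable to both elements of the chain. -/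
/-- The number of linear extensions of the finite poset `α`: bijections
`e : α → {1,…,n}` such that `a < b` implies `e a < e b`. -/
noncomputable def linExtCount (α : Type*) [PartialOrder α] [Fintype α] : ℕ :=
  Set.ncard {e : α ≃ Fin (Fintype.card α) | ∀ a b : α, a < b → e a < e b}

/-- The 2-element antichain, as a poset. -/
def Antichain2 : Type := Fin 2

instance : PartialOrder Antichain2 where
  le x y := x = y
  le_refl _ := rfl
  le_trans _ _ _ h h' := Eq.trans h h'
  le_antisymm _ _ h _ := h

/-- The 3-element poset consisting of a 2-element chain (`0 < 1`) together with a third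
element (`2`) incomparable to both elements of the chain. -/
def ChainPlusOne : Type := Fin 3

instance : Fintype ChainPlusOne := inferInstanceAs (Fintype (Fin 3))
instance : DecidableEq ChainPlusOne := inferInstanceAs (DecidableEq (Fin 3))

instance : PartialOrder ChainPlusOne where
  le x y := Fin.val x = Fin.val y ∨ (Fin.val x = 0 ∧ Fin.val y = 1)
  le_refl x := Or.inl rfl
  le_trans x y z h h' := by
    show Fin.val x = Fin.val z ∨ (Fin.val x = 0 ∧ Fin.val z = 1)
    rcases h with h | ⟨h0, h1⟩ <;> rcases h' with h' | ⟨h0', h1'⟩ <;> omega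
  le_antisymm x y h h' := by
    refine Fin.val_injective ?_
    rcases h with h | ⟨h0, h1⟩ <;> rcases h' with h' | ⟨h0', h1'⟩ <;> omega

/-- The bijections counted by `linExtCount`. -/
def IsLinExt {α : Type*} [PartialOrder α] [Fintype α] (e : α ≃ Fin (Fintype.card α)) : Prop :=
  ∀ a b : α, a < b → e a < e b

section LinearExtensions

variable {α : Type*} [PartialOrder α] [Fintype α]

/-- An injective strictly monotone labelling by natural numbers can be compressed to a linear
extension. -/
theorem exists_linExt_of_injective (g : α → ℕ) (hg : Function.Injective g)
    (hmono : ∀ a b, a < b → g a < g b) :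
    ∃ e : α ≃ Fin (Fintype.card α), IsLinExt e ∧ ∀ x y, e x < e y ↔ g x < g y := by
  classical
  have hc : (Finset.univ.image g).card = Fintype.card α := by
    rw [Finset.card_image_of_injective _ hg, Finset.card_univ]
  let o := (Finset.univ.image g).orderIsoOfFin hc
  let r : α → Finset.univ.image g := fun x => ⟨g x, by simp⟩
  have hr : Function.Bijective r := by
    refine ⟨fun x y h => hg (congrArg Subtype.val h), fun ⟨m, hm⟩ => ?_⟩
    obtain ⟨x, -, rfl⟩ := Finset.mem_image.1 hm
    exact ⟨x, rfl⟩
  have key : ∀ x y, o.symm (r x) < o.symm (r y) ↔ g x < g y := fun x y => by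
    rw [OrderIso.lt_iff_lt]; rfl
  exact ⟨(Equiv.ofBijective r hr).trans o.symm.toEquiv,
    fun a b h => (key a b).2 (hmono a b h), key⟩

omit [PartialOrder α] [Fintype α] in
/-- A bijection to `Fin n` is determined by the order it induces. -/
theorem equiv_fin_eq_of_lt_imp {n : ℕ} {e f : α ≃ Fin n}
    (h : ∀ x y, e x < e y → f x < f y) : e = f := by
  have hm : StrictMono (e.symm.trans f) := fun i j hij => by
    simpa using h (e.symm i) (e.symm j) (by simpa using hij)
  have h1 : hm.orderIsoOfSurjective _ (e.symm.trans f).surjective = OrderIso.refl _ :=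
    Subsingleton.elim _ _
  ext x
  have h2 := DFunLike.congr_fun h1 (e x)
  simp only [StrictMono.orderIsoOfSurjective, OrderIso.refl_apply] at h2
  have h3 : (e.symm.trans f) (e x) = e x := h2
  simp at h3
  rw [h3]

/-- Swapping two consecutive elements of a linear extension that are not related. -/
theorem exists_adjacent_swap {e : α ≃ Fin (Fintype.card α)} (he : IsLinExt e) {a b : α}
    (hab : (e b : ℕ) = e a + 1) (hn : ¬ a < b) :
    ∃ f : α ≃ Fin (Fintype.card α), IsLinExt f ∧
      (f a : ℕ) = e b ∧ (f b : ℕ) = e a ∧ (∀ z, z ≠ a → z ≠ b → (f z : ℕ) = e z) ∧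
      ∀ x y, e x < e y → ¬ (x = a ∧ y = b) → f x < f y := by
  classical
  have h1 : ∀ z, z ≠ a → z ≠ b → ((Equiv.swap a b).trans e) z = e z := fun z ha hb => by
    simp [Equiv.swap_apply_of_ne_of_ne ha hb]
  have h2 : ((Equiv.swap a b).trans e) a = e b := by simp
  have h3 : ((Equiv.swap a b).trans e) b = e a := by simp
  have hlt : ∀ x y, e x < e y → ¬ (x = a ∧ y = b) →
      (Equiv.swap a b).trans e x < (Equiv.swap a b).trans e y := fun x y hxy hne => by
    have hinj : ∀ u v, (e u : ℕ) = e v → u = v := fun u v h => e.injective (Fin.ext h)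
    have hval : ∀ z, (e z : ℕ) = e a ∧ ((Equiv.swap a b).trans e z : ℕ) = e b ∨
        (e z : ℕ) = e b ∧ ((Equiv.swap a b).trans e z : ℕ) = e a ∨
        (e z : ℕ) ≠ e a ∧ (e z : ℕ) ≠ e b ∧ ((Equiv.swap a b).trans e z : ℕ) = e z := fun z => by
      by_cases ha : z = a
      · subst ha; exact Or.inl ⟨rfl, by rw [h2]⟩
      by_cases hb : z = b
      · subst hb; exact Or.inr (Or.inl ⟨rfl, by rw [h3]⟩)
      exact Or.inr (Or.inr
        ⟨fun h => ha (hinj _ _ h), fun h => hb (hinj _ _ h), by rw [h1 z ha hb]⟩)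
    have hne' : ¬ ((e x : ℕ) = e a ∧ (e y : ℕ) = e b) :=
      fun h => hne ⟨hinj _ _ h.1, hinj _ _ h.2⟩
    have hx := hval x
    have hy := hval y
    rw [Fin.lt_def] at hxy ⊢
    omega
  exact ⟨(Equiv.swap a b).trans e,
    fun x y hxy => hlt x y (he x y hxy) (by rintro ⟨rfl, rfl⟩; exact hn hxy),
    by rw [h2], by rw [h3], fun z ha hb => by rw [h1 z ha hb], hlt⟩

/-- If consecutive elements of a segment of a linear extension are related, then the segment is
a chain. -/
theorem lt_of_forall_adjacent_lt {e : α ≃ Fin (Fintype.card α)} {r s : ℕ}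
    (h : ∀ x y, (e y : ℕ) = e x + 1 → r ≤ e x → (e y : ℕ) ≤ s → x < y) {x y : α}
    (hx : r ≤ e x) (hxy : (e x : ℕ) < e y) (hy : (e y : ℕ) ≤ s) : x < y := by
  obtain ⟨d, hd⟩ := Nat.exists_eq_add_of_lt hxy
  induction d generalizing y with
  | zero => exact h x y (by simpa using hd) hx hy
  | succ d ih =>
    let z := e.symm ⟨e x + d + 1, by omega⟩
    have hz : (e z : ℕ) = e x + d + 1 := by simp [z]
    exact (ih (by omega) (by omega) hz).trans (h z y (by omega) (by omega) hy)

/-- Linear extensions are equal if they agree on every pair of consecutive values of a labelling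
that is not related. -/
theorem IsLinExt.eq_of_agree {e f : α ≃ Fin (Fintype.card α)} (he : IsLinExt e) (hf : IsLinExt f)
    {g : α → ℕ} (hg : Function.Injective g)
    (h : ∀ x y, g x < g y → x < y ∨ (e x < e y ↔ f x < f y)) : e = f := by
  refine equiv_fin_eq_of_lt_imp fun x y hxy => ?_
  have hxy' : x ≠ y := by rintro rfl; exact lt_irrefl _ hxy
  have h1 : f x ≠ f y := fun h => hxy' (f.injective h)
  rcases lt_or_gt_of_ne (fun h => hxy' (hg h) : g x ≠ g y) with hlt | hlt
  · rcases h x y hlt with h | h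
    · exact hf _ _ h
    · exact h.1 hxy
  · rcases h y x hlt with h | h
    · exact absurd (he _ _ h) (lt_asymm hxy)
    · exact lt_of_not_ge fun h' => lt_asymm hxy (h.2 (lt_of_le_of_ne h' h1.symm))

/-- A poset obtained from a chain by forgetting one relation between consecutive elements has two
linear extensions. -/
theorem linExtCount_eq_two {g : α → ℕ} (hg : Function.Injective g) {a b : α}
    (hab : g b = g a + 1) (hle : ∀ x y, x < y ↔ g x < g y ∧ ¬ (x = a ∧ y = b)) :
    linExtCount α = 2 := by
  classical
  obtain ⟨e, he, hge⟩ := exists_linExt_of_injective g hg fun x y h => ((hle x y).1 h).1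
  obtain ⟨f, hf, hgf⟩ := exists_linExt_of_injective (g ∘ Equiv.swap a b)
    (hg.comp (Equiv.injective _)) fun x y h => by
      have := (hle x y).1 h
      have := @hg x a
      have := @hg x b
      have := @hg y a
      have := @hg y b
      simp only [Function.comp, Equiv.swap_apply_def]
      grind
  have hea : e a < e b := by rw [hge]; omega
  have hfa : f b < f a := by rw [hgf]; simp; omega
  refine Set.ncard_eq_two.2 ⟨e, f, by rintro rfl; exact lt_asymm hea hfa, ?_⟩
  refine Set.Subset.antisymm (fun k (hk : IsLinExt k) => ?_) (by rintro k (rfl | rfl) <;> assumption)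
  by_cases h : k a < k b
  · refine Or.inl (hk.eq_of_agree he hg fun x y hxy => ?_)
    by_cases hc : x = a ∧ y = b
    · obtain ⟨rfl, rfl⟩ := hc
      exact Or.inr (iff_of_true h hea)
    · exact Or.inl ((hle x y).2 ⟨hxy, hc⟩)
  · refine Or.inr (hk.eq_of_agree hf hg fun x y hxy => ?_)
    by_cases hc : x = a ∧ y = b
    · obtain ⟨rfl, rfl⟩ := hc
      exact Or.inr (iff_of_false h (lt_asymm hfa))
    · exact Or.inl ((hle x y).2 ⟨hxy, hc⟩)

/-- A poset obtained from a chain by making one element incomparable to its predecessor and its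
successor has three linear extensions. -/
theorem linExtCount_eq_three {g : α → ℕ} (hg : Function.Injective g) {a b c : α}
    (hab : g b = g a + 1) (hbc : g c = g b + 1)
    (hle : ∀ x y, x < y ↔ g x < g y ∧ ¬ (x = a ∧ y = b) ∧ ¬ (x = b ∧ y = c)) :
    linExtCount α = 3 := by
  classical
  have hac : a < c := (hle a c).2 ⟨by omega, by rintro ⟨-, rfl⟩; omega, by rintro ⟨rfl, -⟩; omega⟩
  obtain ⟨e, he, hge⟩ := exists_linExt_of_injective g hg fun x y h => ((hle x y).1 h).1
  obtain ⟨f, hf, hgf⟩ := exists_linExt_of_injective (g ∘ Equiv.swap a b)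
    (hg.comp (Equiv.injective _)) fun x y h => by
      have := (hle x y).1 h
      have := @hg x a
      have := @hg x b
      have := @hg y a
      have := @hg y b
      simp only [Function.comp, Equiv.swap_apply_def]
      grind
  obtain ⟨k, hk, hgk⟩ := exists_linExt_of_injective (g ∘ Equiv.swap b c)
    (hg.comp (Equiv.injective _)) fun x y h => by
      have := (hle x y).1 h
      have := @hg x b
      have := @hg x c
      have := @hg y b
      have := @hg y c
      simp only [Function.comp, Equiv.swap_apply_def]
      grind
  have hca : c ≠ a := hac.ne'
  have hcb : c ≠ b := by rintro rfl; omega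
  have hba : b ≠ a := by rintro rfl; omega
  have hea : e a < e b := by rw [hge]; omega
  have heb : e b < e c := by rw [hge]; omega
  have hfa : f b < f a := by rw [hgf]; simp; omega
  have hfb : f b < f c := hfa.trans (hf _ _ hac)
  have hkb : k c < k b := by rw [hgk]; simp; omega
  have hka : k a < k b := (hk _ _ hac).trans hkb
  refine Set.ncard_eq_three.2 ⟨e, f, k, by rintro rfl; exact lt_asymm hea hfa,
    by rintro rfl; exact lt_asymm heb hkb, by rintro rfl; exact lt_asymm hfb hkb, ?_⟩
  refine Set.Subset.antisymm (fun l (hl : IsLinExt l) => ?_)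
    (by rintro l (rfl | rfl | rfl) <;> assumption)
  have key : ∀ m : α ≃ Fin (Fintype.card α), IsLinExt m → (l a < l b ↔ m a < m b) →
      (l b < l c ↔ m b < m c) → l = m := fun m hm h1 h2 => by
    refine hl.eq_of_agree hm hg fun x y hxy => ?_
    by_cases hc : x = a ∧ y = b
    · obtain ⟨rfl, rfl⟩ := hc
      exact Or.inr h1
    · by_cases hc' : x = b ∧ y = c
      · obtain ⟨rfl, rfl⟩ := hc'
        exact Or.inr h2
      · exact Or.inl ((hle x y).2 ⟨hxy, hc, hc'⟩)
  have hlac := hl _ _ hac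
  by_cases h : l a < l b
  · by_cases h' : l b < l c
    · exact Or.inl (key e he (iff_of_true h hea) (iff_of_true h' heb))
    · exact Or.inr (Or.inr (key k hk (iff_of_true h hka) (iff_of_false h' (lt_asymm hkb))))
  · exact Or.inr (Or.inl (key f hf (iff_of_false h (lt_asymm hfa))
      (iff_of_true ((not_lt.1 h).trans_lt hlac) hfb)))

/-- If in `e` and in its swap at `a`, `b` the only consecutive unrelated elements are `a`, `b`,
then all other pairs are related. -/
theorem lt_of_two_linExts {e f : α ≃ Fin (Fintype.card α)} {a b : α}
    (hab : (e b : ℕ) = e a + 1) (hfa : (f a : ℕ) = e b) (hfb : (f b : ℕ) = e a)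
    (hf : ∀ z, z ≠ a → z ≠ b → (f z : ℕ) = e z)
    (hE : ∀ x y, (e y : ℕ) = e x + 1 → x < y ∨ (x = a ∧ y = b))
    (hF : ∀ x y, (f y : ℕ) = f x + 1 → x < y ∨ (x = b ∧ y = a))
    {x y : α} (hxy : (e x : ℕ) < e y) (hne : ¬ (x = a ∧ y = b)) : x < y := by
  have hinj : ∀ u v, (e u : ℕ) = e v → u = v := fun u v h => e.injective (Fin.ext h)
  have hnab : a ≠ b := by rintro rfl; omega
  have e1 : ∀ x y, (e x : ℕ) < e y → (e y : ℕ) ≤ e a → x < y := fun x y h h' =>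
    lt_of_forall_adjacent_lt (r := 0) (fun u v h1 _ h3 =>
      (hE u v h1).resolve_right (by rintro ⟨rfl, rfl⟩; omega)) (Nat.zero_le _) h h'
  have e2 : ∀ x y, (e x : ℕ) < e y → (e b : ℕ) ≤ e x → x < y := fun x y h h' =>
    lt_of_forall_adjacent_lt (s := e y) (fun u v h1 h2 _ =>
      (hE u v h1).resolve_right (by rintro ⟨rfl, rfl⟩; omega)) h' h le_rfl
  have f1 : ∀ x, (e x : ℕ) < e a → x < b := fun x h => by
    have h1 : (f x : ℕ) = e x := hf x (by rintro rfl; omega) (by rintro rfl; omega)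
    exact lt_of_forall_adjacent_lt (e := f) (r := 0) (s := f b) (fun u v h1 _ h3 =>
      (hF u v h1).resolve_right (by rintro ⟨rfl, rfl⟩; omega)) (Nat.zero_le _)
      (by rw [h1, hfb]; exact h) le_rfl
  have f2 : ∀ y, (e b : ℕ) < e y → a < y := fun y h => by
    have h1 : (f y : ℕ) = e y := hf y (by rintro rfl; omega) (by rintro rfl; omega)
    exact lt_of_forall_adjacent_lt (e := f) (r := f a) (s := f y) (fun u v h1 h2 _ =>
      (hF u v h1).resolve_right (by rintro ⟨rfl, rfl⟩; omega)) le_rfl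
      (by rw [h1, hfa]; exact h) le_rfl
  by_cases hy : (e y : ℕ) ≤ e a
  · exact e1 x y hxy hy
  by_cases hx : (e b : ℕ) ≤ e x
  · exact e2 x y hxy hx
  by_cases hxa : (e x : ℕ) < e a
  · by_cases hyb : (e b : ℕ) < e y
    · exact (f1 x hxa).trans (e2 b y hyb le_rfl)
    · obtain rfl := hinj y b (by omega)
      exact f1 x hxa
  · obtain rfl := hinj x a (by omega)
    exact f2 y (by have : (e y : ℕ) ≠ e b := fun h => hne ⟨rfl, hinj y b h⟩; omega)

/-- If `a`, `b`, `c` are consecutive in `e` and the swaps of `e` at `a`, `b` and at `b`, `c` have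
no other consecutive unrelated elements, then all other pairs are related. -/
theorem lt_of_three_linExts {e f k : α ≃ Fin (Fintype.card α)} {a b c : α}
    (hab : (e b : ℕ) = e a + 1) (hbc : (e c : ℕ) = e b + 1)
    (hfa : (f a : ℕ) = e b) (hfb : (f b : ℕ) = e a) (hf : ∀ z, z ≠ a → z ≠ b → (f z : ℕ) = e z)
    (hkb : (k b : ℕ) = e c) (hkc : (k c : ℕ) = e b)
    (hk : ∀ z, z ≠ b → z ≠ c → (k z : ℕ) = e z)
    (hF : ∀ x y, (f y : ℕ) = f x + 1 → x < y ∨ (x = b ∧ y = a))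
    (hK : ∀ x y, (k y : ℕ) = k x + 1 → x < y ∨ (x = c ∧ y = b))
    {x y : α} (hxy : (e x : ℕ) < e y) (hne : ¬ (x = a ∧ y = b)) (hne' : ¬ (x = b ∧ y = c)) :
    x < y := by
  have hinj : ∀ u v, (e u : ℕ) = e v → u = v := fun u v h => e.injective (Fin.ext h)
  have f1 : ∀ x, (e x : ℕ) < e a → x < b := fun x h => by
    have h1 : (f x : ℕ) = e x := hf x (by rintro rfl; omega) (by rintro rfl; omega)
    exact lt_of_forall_adjacent_lt (e := f) (r := 0) (s := f b) (fun u v h1 _ h3 =>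
      (hF u v h1).resolve_right (by rintro ⟨rfl, rfl⟩; omega)) (Nat.zero_le _)
      (by rw [h1, hfb]; exact h) le_rfl
  have f2 : ∀ x y, (f a : ℕ) ≤ f x → (f x : ℕ) < f y → x < y := fun x y h h' =>
    lt_of_forall_adjacent_lt (e := f) (s := f y) (fun u v h1 h2 _ =>
      (hF u v h1).resolve_right (by rintro ⟨rfl, rfl⟩; omega)) h h' le_rfl
  have k1 : ∀ x y, (k x : ℕ) < k y → (k y : ℕ) ≤ k c → x < y := fun x y h h' =>
    lt_of_forall_adjacent_lt (e := k) (r := 0) (fun u v h1 _ h3 =>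
      (hK u v h1).resolve_right (by rintro ⟨rfl, rfl⟩; omega)) (Nat.zero_le _) h h'
  have k2 : ∀ y, (e c : ℕ) < e y → b < y := fun y h => by
    have h1 : (k y : ℕ) = e y := hk y (by rintro rfl; omega) (by rintro rfl; omega)
    exact lt_of_forall_adjacent_lt (e := k) (r := k b) (s := k y) (fun u v h1 h2 _ =>
      (hK u v h1).resolve_right (by rintro ⟨rfl, rfl⟩; omega)) le_rfl
      (by rw [h1, hkb]; exact h) le_rfl
  have hnab : a ≠ b := by rintro rfl; omega
  have hnbc : b ≠ c := by rintro rfl; omega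
  have hnac : a ≠ c := by rintro rfl; omega
  have hka := hk a hnab hnac
  have hfc := hf c hnac.symm hnbc.symm
  by_cases hyb : y = b
  · subst hyb
    have : (e x : ℕ) ≠ e a := fun h => hne ⟨hinj x a h, rfl⟩
    exact f1 x (by omega)
  by_cases hxb : x = b
  · subst hxb
    have : (e y : ℕ) ≠ e c := fun h => hne' ⟨rfl, hinj y c h⟩
    exact k2 y (by omega)
  have low : ∀ u v, u ≠ b → v ≠ b → (e u : ℕ) < e v → (e v : ℕ) ≤ e a → u < v :=
    fun u v hu hv huv hva => by
      have h1 := hk u hu (by rintro rfl; omega)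
      have h2 := hk v hv (by rintro rfl; omega)
      exact k1 u v (by omega) (by omega)
  have high : ∀ u v, u ≠ b → v ≠ b → (e u : ℕ) < e v → (e a : ℕ) ≤ e u → u < v :=
    fun u v hu hv huv hva => by
      have h2 := hf v (by rintro rfl; omega) hv
      by_cases hua : u = a
      · subst hua
        have : (e v : ℕ) ≠ e b := fun h => hv (hinj v b h)
        exact f2 u v le_rfl (by omega)
      · have h1 := hf u hua hu
        have : (e u : ℕ) ≠ e a := fun h => hua (hinj u a h)
        exact f2 u v (by omega) (by omega)
  by_cases hya : (e y : ℕ) ≤ e a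
  · exact low x y hxb hyb hxy hya
  by_cases hxa : (e a : ℕ) ≤ e x
  · exact high x y hxb hyb hxy hxa
  · exact (low x a hxb hnab (by omega) le_rfl).trans (high a y hnab hyb (by omega) le_rfl)

/-- With at least two linear extensions, each of them has consecutive unrelated elements. -/
theorem exists_adjacent_not_lt {p q : α ≃ Fin (Fintype.card α)} (hq : IsLinExt q) (hpq : p ≠ q) :
    ∃ a b, (p b : ℕ) = p a + 1 ∧ ¬ a < b := by
  by_contra! h
  exact hpq (equiv_fin_eq_of_lt_imp fun x y hxy => hq x y
    (lt_of_forall_adjacent_lt (r := 0) (s := p y) (fun u v h1 _ _ => h u v h1)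
      (Nat.zero_le _) hxy le_rfl))

theorem exists_of_linExtCount_eq_two (h : linExtCount α = 2) :
    ∃ (e : α ≃ Fin (Fintype.card α)) (a b : α), (e b : ℕ) = e a + 1 ∧
      ∀ x y, x < y ↔ e x < e y ∧ ¬ (x = a ∧ y = b) := by
  obtain ⟨p, q, hpq, hL⟩ := Set.ncard_eq_two.1 h
  replace hL : ∀ l, IsLinExt l ↔ l = p ∨ l = q := fun l => Set.ext_iff.1 hL l
  have hp := (hL p).2 (Or.inl rfl)
  have hq := (hL q).2 (Or.inr rfl)
  obtain ⟨a, b, hab, hn⟩ := exists_adjacent_not_lt hq hpq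
  obtain ⟨f, hf, hfa, hfb, hfz, hlt⟩ := exists_adjacent_swap hp hab hn
  have hL3 : ∀ l, IsLinExt l → l = p ∨ l = f := by
    have : f ≠ p := by rintro rfl; rw [hfa] at hab; omega
    grind
  refine ⟨p, a, b, hab, fun x y => ⟨fun hxy => ⟨hp x y hxy, by rintro ⟨rfl, rfl⟩; exact hn hxy⟩,
    fun hxy => lt_of_two_linExts hab hfa hfb hfz ?_ ?_ hxy.1 hxy.2⟩⟩
  · intro u v huv
    by_contra! hc
    obtain ⟨k, hk, hku, hkv, -, hklt⟩ := exists_adjacent_swap hp huv hc.1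
    rcases hL3 k hk with rfl | rfl
    · rw [hku] at huv; omega
    · have := hlt u v (Fin.lt_def.2 (by omega)) (by tauto)
      rw [Fin.lt_def] at this
      omega
  · intro u v huv
    by_contra! hc
    obtain ⟨k, hk, hku, hkv, -, hklt⟩ := exists_adjacent_swap hf huv hc.1
    rcases hL3 k hk with rfl | rfl
    · have := hklt b a (by rw [Fin.lt_def]; omega) (by tauto)
      rw [Fin.lt_def] at this
      omega
    · rw [hku] at huv; omega

theorem eq_or_eq_or_eq_of_linExtCount_eq_three (h : linExtCount α = 3)
    {e f k : α ≃ Fin (Fintype.card α)} (he : IsLinExt e) (hf : IsLinExt f) (hk : IsLinExt k)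
    (hef : e ≠ f) (hek : e ≠ k) (hfk : f ≠ k) {l : α ≃ Fin (Fintype.card α)} (hl : IsLinExt l) :
    l = e ∨ l = f ∨ l = k := by
  have hs : ({e, f, k} : Set (α ≃ Fin (Fintype.card α))) = {e | IsLinExt e} :=
    Set.eq_of_subset_of_ncard_le (by rintro l (rfl | rfl | rfl) <;> assumption)
      (by rw [Set.ncard_eq_three.2 ⟨e, f, k, hef, hek, hfk, rfl⟩]; exact h.le) (Set.toFinite _)
  have : l ∈ ({e, f, k} : Set (α ≃ Fin (Fintype.card α))) := hs ▸ hl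
  exact this

/-- With three linear extensions, a linear extension with consecutive `a`, `b`, `c` such that both
`a`, `b` and `b`, `c` are unrelated has all other pairs related. -/
theorem lt_iff_of_linExtCount_eq_three (h : linExtCount α = 3) {e : α ≃ Fin (Fintype.card α)}
    (he : IsLinExt e) {a b c : α} (hab : (e b : ℕ) = e a + 1) (hbc : (e c : ℕ) = e b + 1)
    (hnab : ¬ a < b) (hnbc : ¬ b < c) (x y : α) :
    x < y ↔ e x < e y ∧ ¬ (x = a ∧ y = b) ∧ ¬ (x = b ∧ y = c) := by
  obtain ⟨f, hf, hfa, hfb, hfz, hfl⟩ := exists_adjacent_swap he hab hnab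
  obtain ⟨k, hk, hkb, hkc, hkz, hkl⟩ := exists_adjacent_swap he hbc hnbc
  have hac : a ≠ c := by rintro rfl; omega
  have hca : c ≠ a := hac.symm
  have hba : b ≠ a := by rintro rfl; omega
  have ea : e a < e b := Fin.lt_def.2 (by omega)
  have eb : e b < e c := Fin.lt_def.2 (by omega)
  have fa : f b < f a := Fin.lt_def.2 (by omega)
  have fb : f b < f c := hfl b c eb (by tauto)
  have ka : k a < k b := hkl a b ea (by tauto)
  have kb : k c < k b := Fin.lt_def.2 (by omega)
  have hL : ∀ {l}, IsLinExt l → l = e ∨ l = f ∨ l = k :=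
    eq_or_eq_or_eq_of_linExtCount_eq_three h he hf hk (by rintro rfl; exact lt_asymm ea fa)
      (by rintro rfl; exact lt_asymm eb kb) (by rintro rfl; exact lt_asymm fa ka)
  refine ⟨fun hxy => ⟨he x y hxy, by rintro ⟨rfl, rfl⟩; exact hnab hxy,
    by rintro ⟨rfl, rfl⟩; exact hnbc hxy⟩, fun hxy => ?_⟩
  refine lt_of_three_linExts hab hbc hfa hfb hfz hkb hkc hkz (fun u v huv => ?_)
    (fun u v huv => ?_) hxy.1 hxy.2.1 hxy.2.2 <;> by_contra! hc
  · obtain ⟨m, hm, hmu, hmv, -, hml⟩ := exists_adjacent_swap hf huv hc.1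
    rcases hL hm with rfl | rfl | rfl
    · exact lt_asymm ea (hml b a fa (by grind))
    · omega
    · exact lt_asymm ka (hml b a fa (by grind))
  · obtain ⟨m, hm, hmu, hmv, -, hml⟩ := exists_adjacent_swap hk huv hc.1
    rcases hL hm with rfl | rfl | rfl
    · exact lt_asymm eb (hml c b kb (by grind))
    · exact lt_asymm fb (hml c b kb (by grind))
    · omega

/-- With three linear extensions, two different pairs of consecutive unrelated elements of a linear
extension overlap, and no other pair is unrelated. -/
theorem exists_of_two_adjacent_not_lt (h : linExtCount α = 3) {e : α ≃ Fin (Fintype.card α)}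
    (he : IsLinExt e) {a b x y : α} (hab : (e b : ℕ) = e a + 1) (hxy : (e y : ℕ) = e x + 1)
    (hnab : ¬ a < b) (hnxy : ¬ x < y) (hne : ¬ (x = a ∧ y = b)) :
    ∃ (e : α ≃ Fin (Fintype.card α)) (a b c : α), (e b : ℕ) = e a + 1 ∧ (e c : ℕ) = e b + 1 ∧
      ∀ x y, x < y ↔ e x < e y ∧ ¬ (x = a ∧ y = b) ∧ ¬ (x = b ∧ y = c) := by
  by_cases hbx : b = x
  · subst hbx
    exact ⟨e, a, b, y, hab, hxy, lt_iff_of_linExtCount_eq_three h he hab hxy hnab hnxy⟩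
  by_cases hya : y = a
  · subst hya
    exact ⟨e, x, y, b, hxy, hab, lt_iff_of_linExtCount_eq_three h he hxy hab hnxy hnab⟩
  exfalso
  have hinj : ∀ u v, (e u : ℕ) = e v → u = v := fun u v h => e.injective (Fin.ext h)
  have hxa : x ≠ a := by rintro rfl; exact hne ⟨rfl, hinj _ _ (by omega)⟩
  have hyb : y ≠ b := by rintro rfl; exact hne ⟨hinj _ _ (by omega), rfl⟩
  obtain ⟨f, hf, hfa, hfb, hfz, hfl⟩ := exists_adjacent_swap he hab hnab
  obtain ⟨k, hk, hkx, hky, -, hkl⟩ := exists_adjacent_swap he hxy hnxy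
  have fx := hfz x hxa (Ne.symm hbx)
  have fy := hfz y hya hyb
  obtain ⟨m, hm, hmx, hmy, -, hml⟩ := exists_adjacent_swap hf (a := x) (b := y) (by omega) hnxy
  have ea : e a < e b := Fin.lt_def.2 (by omega)
  have ex : e x < e y := Fin.lt_def.2 (by omega)
  have fa : f b < f a := Fin.lt_def.2 (by omega)
  have fx : f x < f y := Fin.lt_def.2 (by omega)
  have ka : k a < k b := hkl a b ea (by tauto)
  have kx : k y < k x := Fin.lt_def.2 (by omega)
  have ma : m b < m a := hml b a fa (by tauto)
  have mx : m y < m x := Fin.lt_def.2 (by omega)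
  rcases eq_or_eq_or_eq_of_linExtCount_eq_three h he hf hk (by rintro rfl; exact lt_asymm ea fa)
    (by rintro rfl; exact lt_asymm ex kx) (by rintro rfl; exact lt_asymm fa ka) hm
    with rfl | rfl | rfl
  · exact lt_asymm ea ma
  · exact lt_asymm fx mx
  · exact lt_asymm ka ma

theorem exists_of_linExtCount_eq_three (h : linExtCount α = 3) :
    ∃ (e : α ≃ Fin (Fintype.card α)) (a b c : α), (e b : ℕ) = e a + 1 ∧ (e c : ℕ) = e b + 1 ∧
      ∀ x y, x < y ↔ e x < e y ∧ ¬ (x = a ∧ y = b) ∧ ¬ (x = b ∧ y = c) := by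
  obtain ⟨p, q, r, hpq, -, -, hL⟩ := Set.ncard_eq_three.1 h
  have hp : IsLinExt p := hL.ge (Or.inl rfl)
  have hq : IsLinExt q := hL.ge (Or.inr (Or.inl rfl))
  obtain ⟨a, b, hab, hn⟩ := exists_adjacent_not_lt hq hpq
  obtain ⟨f, hf, hfa, hfb, hfz, hlt⟩ := exists_adjacent_swap hp hab hn
  by_cases hE : ∀ u v, (p v : ℕ) = p u + 1 → u < v ∨ (u = a ∧ v = b)
  · by_cases hF : ∀ u v, (f v : ℕ) = f u + 1 → u < v ∨ (u = b ∧ v = a)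
    · have h2 : linExtCount α = 2 :=
        linExtCount_eq_two (g := fun x => (p x : ℕ)) (fun u v h => p.injective (Fin.ext h)) hab
          fun x y => ⟨fun hxy => ⟨hp x y hxy, by rintro ⟨rfl, rfl⟩; exact hn hxy⟩,
            fun hxy => lt_of_two_linExts hab hfa hfb hfz hE hF hxy.1 hxy.2⟩
      omega
    · push Not at hF
      obtain ⟨u, v, huv, hnuv, hne⟩ := hF
      refine exists_of_two_adjacent_not_lt h hf (a := b) (b := a) (by omega) huv (fun hba => ?_)
        hnuv (by tauto)
      have := Fin.lt_def.1 (hp b a hba)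
      omega
  · push Not at hE
    obtain ⟨u, v, huv, hnuv, hne⟩ := hE
    exact exists_of_two_adjacent_not_lt h hp hab huv hn hnuv (by tauto)

end LinearExtensions

section OrdinalSum

/-- The positions of the elements of an ordinal sum `Fin k₁ ⊕ A ⊕ Fin k₂` in the linear extension
given by a bijection from `A` to `Fin m`. -/
def ordinalSumEquiv {A : Type*} {m : ℕ} (k₁ k₂ : ℕ) (σ : A ≃ Fin m) :
    (Fin k₁ ⊕ₗ (A ⊕ₗ Fin k₂)) ≃ Fin (k₁ + (m + k₂)) :=
  ofLex.trans ((Equiv.sumCongr (Equiv.refl _) (ofLex.trans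
    ((Equiv.sumCongr σ (Equiv.refl _)).trans finSumFinEquiv))).trans finSumFinEquiv)

/-- The inclusion of the middle summand in an ordinal sum. -/
def ordinalSumMid {A : Type*} (k₁ k₂ : ℕ) (x : A) : Fin k₁ ⊕ₗ (A ⊕ₗ Fin k₂) :=
  toLex (Sum.inr (toLex (Sum.inl x)))

theorem ordinalSumMid_injective {A : Type*} (k₁ k₂ : ℕ) :
    Function.Injective (ordinalSumMid (A := A) k₁ k₂) := fun x y h => by
  simpa [ordinalSumMid] using h

theorem ordinalSumEquiv_mid {A : Type*} {m : ℕ} (k₁ k₂ : ℕ) (σ : A ≃ Fin m) (x : A) :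
    (ordinalSumEquiv k₁ k₂ σ (ordinalSumMid k₁ k₂ x) : ℕ) = k₁ + σ x := by
  simp [ordinalSumEquiv, ordinalSumMid]

/-- The order of an ordinal sum `Fin k₁ ⊕ A ⊕ Fin k₂` in terms of positions. -/
theorem ordinalSum_lt_iff {A : Type*} [PartialOrder A] {m : ℕ} (k₁ k₂ : ℕ) (σ : A ≃ Fin m)
    (hσ : ∀ x y, x < y → σ x < σ y) (s t : Fin k₁ ⊕ₗ (A ⊕ₗ Fin k₂)) :
    s < t ↔ (ordinalSumEquiv k₁ k₂ σ s : ℕ) < ordinalSumEquiv k₁ k₂ σ t ∧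
      ∀ x y, s = ordinalSumMid k₁ k₂ x → t = ordinalSumMid k₁ k₂ y → x < y := by
  obtain ⟨s, rfl⟩ := toLex.surjective s
  obtain ⟨t, rfl⟩ := toLex.surjective t
  rcases s with i | s <;> rcases t with j | t
  · simp [ordinalSumEquiv, ordinalSumMid]
  · simp [ordinalSumEquiv, ordinalSumMid, -Fin.val_fin_lt]
    omega
  · simp [ordinalSumEquiv, ordinalSumMid, -Fin.val_fin_lt]
    omega
  obtain ⟨s, rfl⟩ := toLex.surjective s
  obtain ⟨t, rfl⟩ := toLex.surjective t
  rcases s with i | s <;> rcases t with j | t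
  · simpa [ordinalSumEquiv, ordinalSumMid] using hσ i j
  · simp [ordinalSumEquiv, ordinalSumMid, -Fin.val_fin_lt]
    omega
  · simp [ordinalSumEquiv, ordinalSumMid, -Fin.val_fin_lt]
    omega
  · simp [ordinalSumEquiv, ordinalSumMid]

/-- The elements of `Antichain2` in a linear order. -/
def antichain2Equiv : Antichain2 ≃ Fin 2 := Equiv.refl (Fin 2)

/-- The elements of `ChainPlusOne` in a linear order, the isolated element being in the middle. -/
def chainPlusOneEquiv : ChainPlusOne ≃ Fin 3 := (Equiv.swap 1 2 : Equiv.Perm (Fin 3))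

theorem antichain2_not_lt (x y : Antichain2) : ¬ x < y := fun h => h.ne h.le

theorem chainPlusOne_lt_iff (x y : ChainPlusOne) :
    x < y ↔ chainPlusOneEquiv x = 0 ∧ chainPlusOneEquiv y = 2 := by
  have hlt : x < y ↔ Fin.val x = 0 ∧ Fin.val y = 1 := by
    rw [lt_iff_le_and_ne]
    constructor
    · rintro ⟨h | h, hne⟩
      · exact absurd (Fin.ext h) hne
      · exact h
    · rintro h
      exact ⟨Or.inr h, fun he => by rw [he] at h; omega⟩
  have hval : ∀ x y : Fin 3, x.val = 0 ∧ y.val = 1 ↔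
      Equiv.swap (1 : Fin 3) 2 x = 0 ∧ Equiv.swap (1 : Fin 3) 2 y = 2 := by decide
  exact hlt.trans (hval x y)

theorem antichain2Sum_lt_iff (k₁ k₂ : ℕ) (s t : Fin k₁ ⊕ₗ (Antichain2 ⊕ₗ Fin k₂)) :
    s < t ↔ (ordinalSumEquiv k₁ k₂ antichain2Equiv s : ℕ) <
        ordinalSumEquiv k₁ k₂ antichain2Equiv t ∧
      ¬ (s = ordinalSumMid k₁ k₂ (antichain2Equiv.symm 0) ∧
        t = ordinalSumMid k₁ k₂ (antichain2Equiv.symm 1)) := by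
  refine (ordinalSum_lt_iff k₁ k₂ antichain2Equiv
    (fun x y h => absurd h (antichain2_not_lt x y)) s t).trans (and_congr_right fun hlt => ?_)
  refine ⟨fun h hst => antichain2_not_lt _ _ (h _ _ hst.1 hst.2), ?_⟩
  rintro hne x y rfl rfl
  rw [ordinalSumEquiv_mid, ordinalSumEquiv_mid] at hlt
  refine absurd ⟨congrArg _ (antichain2Equiv.eq_symm_apply.2 ?_),
    congrArg _ (antichain2Equiv.eq_symm_apply.2 ?_)⟩ hne <;> ext <;> simp <;> omega

theorem chainPlusOneSum_lt_iff (k₁ k₂ : ℕ) (s t : Fin k₁ ⊕ₗ (ChainPlusOne ⊕ₗ Fin k₂)) :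
    s < t ↔ (ordinalSumEquiv k₁ k₂ chainPlusOneEquiv s : ℕ) <
        ordinalSumEquiv k₁ k₂ chainPlusOneEquiv t ∧
      ¬ (s = ordinalSumMid k₁ k₂ (chainPlusOneEquiv.symm 0) ∧
        t = ordinalSumMid k₁ k₂ (chainPlusOneEquiv.symm 1)) ∧
      ¬ (s = ordinalSumMid k₁ k₂ (chainPlusOneEquiv.symm 1) ∧
        t = ordinalSumMid k₁ k₂ (chainPlusOneEquiv.symm 2)) := by
  refine (ordinalSum_lt_iff k₁ k₂ chainPlusOneEquiv (fun x y h => ?_) s t).trans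
    (and_congr_right fun hlt => ⟨fun h => ⟨fun hst => ?_, fun hst => ?_⟩, ?_⟩)
  · obtain ⟨hx, hy⟩ := (chainPlusOne_lt_iff x y).1 h
    rw [hx, hy]
    decide
  · simpa [chainPlusOne_lt_iff] using h _ _ hst.1 hst.2
  · simpa [chainPlusOne_lt_iff] using h _ _ hst.1 hst.2
  · rintro ⟨hne, hne'⟩ x y rfl rfl
    rw [ordinalSumEquiv_mid, ordinalSumEquiv_mid] at hlt
    simp only [(ordinalSumMid_injective k₁ k₂).eq_iff, Equiv.eq_symm_apply] at hne hne'
    rw [chainPlusOne_lt_iff]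
    omega

theorem nonempty_orderIso_of_lt_iff {α β : Type*} [PartialOrder α] [PartialOrder β] (φ : α ≃ β)
    (h : ∀ x y, x < y ↔ φ x < φ y) : Nonempty (α ≃o β) :=
  ⟨φ, fun {x y} => by rw [le_iff_lt_or_eq, le_iff_lt_or_eq, h, φ.injective.eq_iff]⟩

end OrdinalSum

/-- Lemma 6.2: a finite poset has exactly 2 linear extensions iff it is an ordinal sum
`C₁ ⊕ A ⊕ C₂` of a (possibly empty) chain, a 2-element antichain and a (possibly empty)
chain; and it has exactly 3 linear extensions iff it is an ordinal sum `C₁ ⊕ A ⊕ C₂`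
where `A` is a 2-element chain plus one element incomparable to both. -/
theorem stmt17 (α : Type*) [PartialOrder α] [Fintype α] :
    (linExtCount α = 2 ↔
      ∃ k₁ k₂ : ℕ, Nonempty (α ≃o (Fin k₁ ⊕ₗ (Antichain2 ⊕ₗ Fin k₂)))) ∧
    (linExtCount α = 3 ↔
      ∃ k₁ k₂ : ℕ, Nonempty (α ≃o (Fin k₁ ⊕ₗ (ChainPlusOne ⊕ₗ Fin k₂)))) := by
  refine ⟨⟨fun h => ?_, ?_⟩, ⟨fun h => ?_, ?_⟩⟩
  · obtain ⟨e, a, b, hab, hlt⟩ := exists_of_linExtCount_eq_two h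
    obtain ⟨k₂, hk⟩ := Nat.exists_eq_add_of_le (show (e a : ℕ) + 2 ≤ Fintype.card α by omega)
    let P := ordinalSumEquiv (e a) k₂ antichain2Equiv
    let φ := (e.trans (finCongr (by omega : Fintype.card α = e a + (2 + k₂)))).trans P.symm
    have hP : ∀ x, (P (φ x) : ℕ) = e x := fun x => by simp [φ]
    have hφ : ∀ x i, φ x = ordinalSumMid (e a) k₂ (antichain2Equiv.symm i) ↔
        (e x : ℕ) = e a + i := fun x i => by
      rw [← P.injective.eq_iff, Fin.ext_iff, hP, ordinalSumEquiv_mid, Equiv.apply_symm_apply]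
    refine ⟨e a, k₂, nonempty_orderIso_of_lt_iff φ fun x y => ?_⟩
    rw [hlt, antichain2Sum_lt_iff, hP, hP, hφ, hφ, Fin.lt_def, ← e.injective.eq_iff,
      ← e.injective.eq_iff, Fin.ext_iff, Fin.ext_iff, hab]
    simp
  · rintro ⟨k₁, k₂, ⟨φ⟩⟩
    refine linExtCount_eq_two (g := fun x => (ordinalSumEquiv k₁ k₂ antichain2Equiv (φ x) : ℕ))
      (a := φ.symm (ordinalSumMid k₁ k₂ (antichain2Equiv.symm 0)))
      (b := φ.symm (ordinalSumMid k₁ k₂ (antichain2Equiv.symm 1)))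
      (Fin.val_injective.comp ((Equiv.injective _).comp φ.injective))
      (by simp [ordinalSumEquiv_mid]) fun x y => ?_
    rw [← φ.lt_iff_lt, antichain2Sum_lt_iff, OrderIso.eq_symm_apply, OrderIso.eq_symm_apply]
  · obtain ⟨e, a, b, c, hab, hbc, hlt⟩ := exists_of_linExtCount_eq_three h
    obtain ⟨k₂, hk⟩ := Nat.exists_eq_add_of_le (show (e a : ℕ) + 3 ≤ Fintype.card α by omega)
    let P := ordinalSumEquiv (e a) k₂ chainPlusOneEquiv
    let φ := (e.trans (finCongr (by omega : Fintype.card α = e a + (3 + k₂)))).trans P.symm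
    have hP : ∀ x, (P (φ x) : ℕ) = e x := fun x => by simp [φ]
    have hφ : ∀ x i, φ x = ordinalSumMid (e a) k₂ (chainPlusOneEquiv.symm i) ↔
        (e x : ℕ) = e a + i := fun x i => by
      rw [← P.injective.eq_iff, Fin.ext_iff, hP, ordinalSumEquiv_mid, Equiv.apply_symm_apply]
    refine ⟨e a, k₂, nonempty_orderIso_of_lt_iff φ fun x y => ?_⟩
    rw [hlt, chainPlusOneSum_lt_iff, hP, hP, hφ, hφ, hφ, hφ, Fin.lt_def]
    simp only [← e.injective.eq_iff, Fin.ext_iff, hab, hbc]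
    simp [add_assoc]
  · rintro ⟨k₁, k₂, ⟨φ⟩⟩
    refine linExtCount_eq_three
      (g := fun x => (ordinalSumEquiv k₁ k₂ chainPlusOneEquiv (φ x) : ℕ))
      (a := φ.symm (ordinalSumMid k₁ k₂ (chainPlusOneEquiv.symm 0)))
      (b := φ.symm (ordinalSumMid k₁ k₂ (chainPlusOneEquiv.symm 1)))
      (c := φ.symm (ordinalSumMid k₁ k₂ (chainPlusOneEquiv.symm 2)))
      (Fin.val_injective.comp ((Equiv.injective _).comp φ.injective))
      (by simp [ordinalSumEquiv_mid]) (by simp [ordinalSumEquiv_mid]) fun x y => ?_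
    rw [← φ.lt_iff_lt, chainPlusOneSum_lt_iff]
    simp only [OrderIso.eq_symm_apply]
end
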